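/- arXiv:2406.14342 — 7 statements merged into one kernel-verified Lean document; each statement's English description precedes it below -/
import Mathlib

section
/- Let s, b ∈ ℝ and let η : ℝ → ℂ be a Schwartz function. Then there exists a constant C > 0 (depending only on s, b, η) such that for every Schwartz function u₀ : ℝ → ℂ, the function u(x,t) := η(t)·(W(t)u₀)(x) satisfies (∬_{ℝ²} ⟨ξ⟩^{2s} ⟨τ+ξ⁵⟩^{2b} |û(ξ,τ)|² dξ dτ)^{1/2} ≤ C (∫_ℝ ⟨ξ⟩^{2s} |û₀(ξ)|² dξ)^{1/2}, where û denotes the Fourier transform of u on ℝ² and û₀ the Fourier transform of u₀ on ℝ. -/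
open MeasureTheory
open scoped Real

/-- Fourier transform on ℝ: `f̂(ξ) = (2π)^{-1/2} ∫ e^{-iξx} f(x) dx`. -/
noncomputable def FT1 (f : ℝ → ℂ) (ξ : ℝ) : ℂ :=
  (Real.sqrt (2 * π) : ℂ)⁻¹ * ∫ x : ℝ, Complex.exp (-Complex.I * ξ * x) * f x

/-- Fourier transform on ℝ²: `f̂(ξ,τ) = (2π)^{-1} ∬ e^{-i(xξ+tτ)} f(x,t) dx dt`. -/
noncomputable def FT2 (f : ℝ → ℝ → ℂ) (ξ τ : ℝ) : ℂ :=
  ((2 * π : ℝ) : ℂ)⁻¹ * ∫ x : ℝ, ∫ t : ℝ, Complex.exp (-Complex.I * (x * ξ + t * τ)) * f x t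

/-- Bourgain `X^{s,b}` norm associated to `∂_t + ∂_x⁵`. -/
noncomputable def Xnorm (s b : ℝ) (f : ℝ → ℝ → ℂ) : ℝ :=
  Real.sqrt (∫ ξ : ℝ, ∫ τ : ℝ,
    (1 + |ξ|) ^ (2 * s) * (1 + |τ + ξ ^ 5|) ^ (2 * b) * ‖FT2 f ξ τ‖ ^ 2)

/-- Free propagator of `∂_t + ∂_x⁵`: `(W(t)u₀)(x) = (2π)^{-1/2} ∫ e^{ixξ} e^{-itξ⁵} û₀(ξ) dξ`. -/
noncomputable def Wprop (u₀ : ℝ → ℂ) (t x : ℝ) : ℂ :=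
  (Real.sqrt (2 * π) : ℂ)⁻¹ *
    ∫ ξ : ℝ, Complex.exp (Complex.I * (x * ξ - t * ξ ^ 5)) * FT1 u₀ ξ

open FourierTransform in
lemma FT1_schwartz (f : SchwartzMap ℝ ℂ) : ∃ F : SchwartzMap ℝ ℂ, ∀ ξ, F ξ = FT1 f ξ := by
  have hg : Function.HasTemperateGrowth (fun x : ℝ => (2 * π)⁻¹ * x) := by fun_prop
  refine ⟨(Real.sqrt (2 * π) : ℂ)⁻¹ • SchwartzMap.compCLM ℂ hg ⟨1, 2 * π, fun x => ?_⟩ (𝓕 f), fun ξ => ?_⟩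
  · have hpi := Real.pi_pos
    have : |x| = 2 * π * ((2 * π)⁻¹ * |x|) := by field_simp
    rw [norm_mul, Real.norm_eq_abs, Real.norm_eq_abs, abs_of_pos (by positivity : (0:ℝ) < (2 * π)⁻¹), pow_one, mul_add, ← this]
    linarith
  · have hpi : (π : ℂ) ≠ 0 := by exact_mod_cast Real.pi_ne_zero
    change (Real.sqrt (2 * π) : ℂ)⁻¹ * (𝓕 f) ((2 * π)⁻¹ * ξ) = _
    rw [SchwartzMap.fourier_coe, Real.fourier_eq', FT1]
    congr 1
    apply integral_congr_ae
    filter_upwards with x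
    simp only [smul_eq_mul, RCLike.inner_apply, conj_trivial]
    congr 2
    push_cast
    field_simp

open FourierTransform in
lemma inversion (g : SchwartzMap ℝ ℂ) (ξ : ℝ) :
    ∫ x : ℝ, Complex.exp (-Complex.I * (x * ξ)) *
      ∫ ζ : ℝ, Complex.exp (Complex.I * (x * ζ)) * g ζ = (2 * π : ℝ) * g ξ := by
  have hpi : (π : ℂ) ≠ 0 := by exact_mod_cast Real.pi_ne_zero
  have h1 : g ξ = 𝓕 (𝓕⁻ g) ξ := by simp
  rw [SchwartzMap.fourier_coe, Real.fourier_eq'] at h1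
  have h2 := Measure.integral_comp_mul_left
    (fun v : ℝ => Complex.exp (((-2 * π * inner ℝ v ξ : ℝ) : ℂ) * Complex.I) • (𝓕⁻ g) v) ((2 * π)⁻¹)
  rw [← h1, inv_inv, abs_of_pos (by positivity), Complex.real_smul] at h2
  rw [← h2]
  apply integral_congr_ae
  filter_upwards with x
  rw [SchwartzMap.fourierInv_coe, Real.fourierInv_eq', smul_eq_mul]
  congr 1
  · congr 1
    simp only [RCLike.inner_apply, conj_trivial]
    push_cast
    field_simp
  · apply integral_congr_ae
    filter_upwards with y
    simp only [smul_eq_mul, RCLike.inner_apply, conj_trivial]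
    congr 2
    push_cast
    field_simp

lemma FT2_eq (η u₀ : SchwartzMap ℝ ℂ) (ξ τ : ℝ) :
    FT2 (fun x t => η t * Wprop u₀ t x) ξ τ = FT1 u₀ ξ * FT1 η (τ + ξ ^ 5) := by
  obtain ⟨U, hU⟩ := FT1_schwartz u₀
  obtain ⟨E, hE⟩ := FT1_schwartz η
  have hpi : (π : ℂ) ≠ 0 := by exact_mod_cast Real.pi_ne_zero
  have hs : (Real.sqrt (2 * π) : ℂ) ≠ 0 := by
    exact_mod_cast (Real.sqrt_pos.2 (by positivity : (0:ℝ) < 2 * π)).ne'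
  have hp : Function.HasTemperateGrowth (fun ζ : ℝ => τ + ζ ^ 5) := by fun_prop
  have hg : Function.HasTemperateGrowth (fun ζ : ℝ => E (τ + ζ ^ 5)) :=
    E.hasTemperateGrowth.comp hp
  let g : SchwartzMap ℝ ℂ := SchwartzMap.smulLeftCLM ℂ (fun ζ : ℝ => E (τ + ζ ^ 5)) U
  have hgv : ∀ ζ, g ζ = E (τ + ζ ^ 5) * U ζ := fun ζ => by
    simp only [g, SchwartzMap.smulLeftCLM_apply_apply hg, smul_eq_mul]
  have key : ∀ x : ℝ, ∫ t : ℝ, Complex.exp (-Complex.I * (x * ξ + t * τ)) * (η t * Wprop u₀ t x)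
      = Complex.exp (-Complex.I * (x * ξ)) *
      ∫ ζ : ℝ, Complex.exp (Complex.I * (x * ζ)) * g ζ := by
    intro x
    have e1 : ∀ t : ℝ, Complex.exp (-Complex.I * (x * ξ + t * τ)) * (η t * Wprop u₀ t x)
      = Complex.exp (-Complex.I * (x * ξ)) * ((Real.sqrt (2 * π) : ℂ)⁻¹ * ∫ ζ : ℝ,
        Complex.exp (-Complex.I * (t * τ)) * η t * (Complex.exp (Complex.I * (x * ζ - t * ζ ^ 5)) * U ζ)) := by
      intro t
      rw [integral_const_mul, Wprop, mul_add, Complex.exp_add]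
      simp only [hU]
      ring
    simp_rw [e1]
    rw [integral_const_mul, integral_const_mul, integral_integral_swap, ← integral_const_mul]
    · congr 1
      apply integral_congr_ae
      filter_upwards with ζ
      rw [hgv, hE, FT1]
      have : ∀ t : ℝ, Complex.exp (-Complex.I * (t * τ)) * η t * (Complex.exp (Complex.I * (x * ζ - t * ζ ^ 5)) * U ζ)
        = (Complex.exp (Complex.I * (x * ζ)) * U ζ) * (Complex.exp (-Complex.I * (τ + ζ ^ 5 : ℝ) * t) * η t) := by
        intro t
        have : Complex.exp (-Complex.I * (t * τ)) * Complex.exp (Complex.I * (x * ζ - t * ζ ^ 5))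
          = Complex.exp (Complex.I * (x * ζ)) * Complex.exp (-Complex.I * (τ + ζ ^ 5 : ℝ) * t) := by
          rw [← Complex.exp_add, ← Complex.exp_add]
          congr 1
          push_cast
          ring
        linear_combination (η t * U ζ) * this
      simp_rw [this]
      rw [integral_const_mul]
      ring
    · have hi : Integrable (fun z : ℝ × ℝ => η z.1 * U z.2) (volume.prod volume) :=
        η.integrable.mul_prod U.integrable
      refine hi.mono ?_ ?_
      · have h1 := η.continuous
        have h2 := U.continuous
        apply Continuous.aestronglyMeasurable
        unfold Function.uncurry
        fun_prop
      · filter_upwards with z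
        have n1 : ‖Complex.exp (-Complex.I * (z.1 * τ))‖ = 1 := by
          rw [Complex.norm_exp]; simp
        have n2 : ‖Complex.exp (Complex.I * (x * z.2 - z.1 * z.2 ^ 5))‖ = 1 := by
          have : Complex.I * (x * z.2 - z.1 * z.2 ^ 5) = ((x * z.2 - z.1 * z.2 ^ 5 : ℝ) : ℂ) * Complex.I := by
            push_cast; ring
          rw [this, Complex.norm_exp_ofReal_mul_I]
        simp only [Function.uncurry, norm_mul, n1, n2, one_mul, le_refl]
  rw [FT2]
  simp_rw [key]
  rw [inversion, hgv, hU, hE]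
  push_cast
  field_simp

theorem stmt0 (s b : ℝ) (η : SchwartzMap ℝ ℂ) :
    ∃ C > (0 : ℝ), ∀ u₀ : SchwartzMap ℝ ℂ,
      Xnorm s b (fun x t => η t * Wprop u₀ t x) ≤
        C * Real.sqrt (∫ ξ : ℝ, (1 + |ξ|) ^ (2 * s) * ‖FT1 u₀ ξ‖ ^ 2) := by
  set K : ℝ := ∫ τ : ℝ, (1 + |τ|) ^ (2 * b) * ‖FT1 η τ‖ ^ 2 with hK
  have hK0 : 0 ≤ K := integral_nonneg fun τ => by positivity
  refine ⟨Real.sqrt K + 1, by positivity, fun u₀ => ?_⟩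
  have h : ∀ ξ : ℝ, ∫ τ : ℝ, (1 + |ξ|) ^ (2 * s) * (1 + |τ + ξ ^ 5|) ^ (2 * b) *
      ‖FT2 (fun x t => η t * Wprop u₀ t x) ξ τ‖ ^ 2
      = K * ((1 + |ξ|) ^ (2 * s) * ‖FT1 u₀ ξ‖ ^ 2) := by
    intro ξ
    rw [hK, ← integral_add_right_eq_self (μ := volume)
      (fun τ : ℝ => (1 + |τ|) ^ (2 * b) * ‖FT1 η τ‖ ^ 2) (ξ ^ 5), ← integral_mul_const]
    apply integral_congr_ae
    filter_upwards with τ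
    rw [FT2_eq, norm_mul]
    ring
  rw [Xnorm]
  simp_rw [h]
  rw [integral_const_mul, Real.sqrt_mul hK0]
  gcongr
  linarith
end

section
/- Let s ∈ ℝ, let b, b' satisfy -1/2 < b' ≤ 0 ≤ b ≤ b' + 1, and let η ∈ C_0^∞(ℝ) with supp η ⊂ [-1,1] and η ≡ 1 on [-1/2,1/2]. Then there exists C > 0 (depending only on s, b, b', η) such that for every T ∈ (0,1] and every Schwartz function f : ℝ² → ℂ, the function g(x,t) := η(t/T) ∫_0^t (W(t-t') f(·,t'))(x) dt' satisfies ‖g‖_{X^{s,b}} ≤ C T^{1-b+b'} ‖f‖_{X^{s,b'}}. -/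
open MeasureTheory
open scoped Real

/-- `W(s)` applied in the `x`-variable to `f(·, t')`, evaluated at `x`:
`(W(s) f(·,t'))(x) = (2π)^{-1/2} ∫ e^{ixξ} e^{-isξ⁵} (f(·,t'))^∧(ξ) dξ`. -/
noncomputable def WpF (f : ℝ × ℝ → ℂ) (s t' x : ℝ) : ℂ :=
  (Real.sqrt (2 * π) : ℂ)⁻¹ *
    ∫ ξ : ℝ, Complex.exp (Complex.I * (x * ξ - s * ξ ^ 5)) * FT1 (fun y => f (y, t')) ξ


/-- Unimodular exponential `e^{ir}`. -/
noncomputable def ex (r : ℝ) : ℂ := Complex.exp (Complex.I * (r : ℂ))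

lemma ex_norm (r : ℝ) : ‖ex r‖ = 1 := by
  unfold ex; exact Complex.norm_exp_I_mul_ofReal r

@[fun_prop]
lemma ex_cont : Continuous ex := by unfold ex; fun_prop

lemma ex_add (a b : ℝ) : ex (a + b) = ex a * ex b := by
  unfold ex; rw [← Complex.exp_add]; push_cast; ring_nf

lemma ex_zero : ex 0 = 1 := by simp [ex]

lemma fourier_eq_ex (h : ℝ → ℂ) (w : ℝ) :
    FourierTransform.fourier h w = ∫ t : ℝ, ex (-(t * (2 * π * w))) * h t := by
  rw [Real.fourier_real_eq_integral_exp_smul]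
  congr 1; ext t; simp only [smul_eq_mul, ex]; congr 2; push_cast; ring

lemma inv1 (h : ℝ → ℂ) (hc : Continuous h) (hi : Integrable h)
    (hH : Integrable (fun τ : ℝ => ∫ t : ℝ, ex (-(t * τ)) * h t)) (t : ℝ) :
    ∫ τ : ℝ, ex (t * τ) * (∫ u : ℝ, ex (-(u * τ)) * h u) = (2 * π : ℝ) * h t := by
  have hpi : (2 * π : ℝ) ≠ 0 := by positivity
  have h1 : Integrable (FourierTransform.fourier h) := by
    have := hH.comp_mul_left' (R := 2 * π) hpi
    refine this.congr (Filter.Eventually.of_forall fun w => ?_)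
    simp only [fourier_eq_ex]
  have h2 := congrFun (hc.fourierInv_fourier_eq hi h1) t
  rw [Real.fourierInv_eq'] at h2
  have h3 := Measure.integral_comp_mul_left
    (fun τ : ℝ => ex (t * τ) * (∫ u : ℝ, ex (-(u * τ)) * h u)) (2 * π)
  have h4 : (fun v : ℝ => Complex.exp (↑(2 * π * inner ℝ v t) * Complex.I) •
      FourierTransform.fourier h v) =
      fun v => ex (t * (2 * π * v)) * (∫ u : ℝ, ex (-(u * (2 * π * v))) * h u) := by
    ext v
    rw [fourier_eq_ex, smul_eq_mul]
    congr 1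
    simp only [ex]; congr 1
    simp; ring
  rw [h4, h3] at h2
  rw [← h2, abs_of_pos (by positivity)]
  rw [Complex.real_smul, ← mul_assoc, ← Complex.ofReal_mul, mul_inv_cancel₀ hpi]
  simp

lemma inv2 (h : ℝ → ℂ) (hc : Continuous h) (hi : Integrable h)
    (hH : Integrable (fun τ : ℝ => ∫ t : ℝ, ex (t * τ) * h t)) (t : ℝ) :
    ∫ τ : ℝ, ex (-(t * τ)) * (∫ u : ℝ, ex (u * τ) * h u) = (2 * π : ℝ) * h t := by
  have key : ∀ τ : ℝ, ∫ u : ℝ, ex (-(u * τ)) * h (-u) = ∫ u : ℝ, ex (u * τ) * h u := by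
    intro τ
    rw [← integral_neg_eq_self]
    congr 1; ext u; simp
  have := inv1 (fun u => h (-u)) (by fun_prop) hi.comp_neg (by simpa only [key] using hH) (-t)
  simpa only [key, neg_neg, neg_mul] using this

lemma FT2_schwartz (f : SchwartzMap (ℝ × ℝ) ℂ) :
    ∃ S : SchwartzMap (ℝ × ℝ) ℂ, ∀ ξ τ, FT2 (fun x t => f (x, t)) ξ τ = S (ξ, τ) := by
  let e := WithLp.prodContinuousLinearEquiv 2 ℝ ℝ ℝ
  have hpi : (2 * π : ℝ)⁻¹ ≠ 0 := by positivity
  let d : (ℝ × ℝ) ≃L[ℝ] (ℝ × ℝ) := ContinuousLinearEquiv.smulLeft (Units.mk0 ((2 * π : ℝ)⁻¹) hpi)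
  let f1 : SchwartzMap (WithLp 2 (ℝ × ℝ)) ℂ := SchwartzMap.compCLMOfContinuousLinearEquiv ℂ e f
  let S0 : SchwartzMap (WithLp 2 (ℝ × ℝ)) ℂ := FourierTransform.fourier f1
  let S1 : SchwartzMap (ℝ × ℝ) ℂ :=
    SchwartzMap.compCLMOfContinuousLinearEquiv ℂ (d.trans e.symm) S0
  refine ⟨((2 * π : ℝ) : ℂ)⁻¹ • S1, fun ξ τ => ?_⟩
  have h1 : S1 (ξ, τ) = FourierTransform.fourier (⇑f1) (e.symm (d (ξ, τ))) := by
    rw [← SchwartzMap.fourier_coe]; rfl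
  rw [smul_apply, smul_eq_mul, FT2, h1, Real.fourier_eq']
  congr 1
  have h2 := (WithLp.volume_preserving_ofLp ℝ ℝ).integral_comp
    (MeasurableEquiv.toLp 2 (ℝ × ℝ)).symm.measurableEmbedding
    (fun p : ℝ × ℝ => ex (-(p.1 * ξ + p.2 * τ)) * f p)
  have h3 : Integrable (fun p : ℝ × ℝ => ex (-(p.1 * ξ + p.2 * τ)) * f p)
      ((volume : Measure ℝ).prod volume) := by
    refine (f.integrable (μ := (volume : Measure ℝ).prod volume)).bdd_mul (c := 1) ?_ ?_
    · exact Continuous.aestronglyMeasurable (by fun_prop)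
    · exact Filter.Eventually.of_forall fun p => (ex_norm _).le
  have h4 := integral_prod _ h3
  rw [← Measure.volume_eq_prod] at h4
  rw [h4] at h2
  have e1 : (∫ x : ℝ, ∫ t : ℝ, Complex.exp (-Complex.I * (x * ξ + t * τ)) * f (x, t)) =
    ∫ x : ℝ, ∫ t : ℝ, ex (-(x * ξ + t * τ)) * f (x, t) := by
    congr 1; ext x; congr 1; ext t; simp only [ex]; congr 2; push_cast; ring
  rw [e1, ← h2]
  congr 1; ext v
  simp only [smul_eq_mul]
  congr 1
  simp only [ex]; congr 1
  have : inner ℝ v (e.symm (d (ξ, τ))) = (2 * π : ℝ)⁻¹ * (v.ofLp.1 * ξ + v.ofLp.2 * τ) := by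
    have hd : d (ξ, τ) = ((2 * π : ℝ)⁻¹ * ξ, (2 * π : ℝ)⁻¹ * τ) := rfl
    rw [WithLp.prod_inner_apply, hd]
    change (2 * π : ℝ)⁻¹ * ξ * v.ofLp.1 + (2 * π : ℝ)⁻¹ * τ * v.ofLp.2 = _
    ring
  rw [this]
  have hpi' : (π : ℂ) ≠ 0 := by exact_mod_cast Real.pi_ne_zero
  push_cast
  field_simp

lemma cs (p q : ℝ → ENNReal) (hp : Measurable p) (hq : Measurable q) :
    (∫⁻ a, p a * q a) ^ 2 ≤ (∫⁻ a, p a ^ 2) * (∫⁻ a, q a ^ 2) := by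
  have := ENNReal.lintegral_mul_le_Lp_mul_Lq volume Real.HolderConjugate.two_two
    hp.aemeasurable hq.aemeasurable
  simp only [Pi.mul_apply] at this
  calc _ ≤ _ := pow_le_pow_left' this 2
    _ = _ := by
      rw [mul_pow, ← ENNReal.rpow_natCast, ← ENNReal.rpow_natCast, ← ENNReal.rpow_mul,
        ← ENNReal.rpow_mul]
      norm_num

lemma schur (k1 k2 k3 w : ℝ → ENNReal) (h1 : Measurable k1) (h2 : Measurable k2)
    (h3 : Measurable k3) (hw : Measurable w) :
    ∫⁻ τ, (∫⁻ σ, (k1 (τ - σ) + k2 τ * k3 σ) * w σ) ^ 2 ≤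
      4 * ((∫⁻ a, k1 a) ^ 2 + (∫⁻ a, k2 a ^ 2) * (∫⁻ a, k3 a ^ 2)) * ∫⁻ a, w a ^ 2 := by
  have hA : ∀ τ, (∫⁻ σ, k1 (τ - σ) * w σ) ^ 2 ≤ (∫⁻ a, k1 a) * ∫⁻ σ, k1 (τ - σ) * w σ ^ 2 := by
    intro τ
    have := cs (fun σ => k1 (τ - σ) ^ (1 / 2 : ℝ)) (fun σ => k1 (τ - σ) ^ (1 / 2 : ℝ) * w σ)
      (by fun_prop) (by fun_prop)
    have e0 : ∀ x : ENNReal, x ^ (1 / 2 : ℝ) * x ^ (1 / 2 : ℝ) = x := by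
      intro x; rw [← ENNReal.rpow_add_of_nonneg _ _ (by norm_num) (by norm_num)]; norm_num
    have e1 : ∀ x y : ENNReal, x ^ (1 / 2 : ℝ) * (x ^ (1 / 2 : ℝ) * y) = x * y := by
      intro x y; rw [← mul_assoc, e0]
    have e2 : ∀ x : ENNReal, (x ^ (1 / 2 : ℝ)) ^ 2 = x := by
      intro x; rw [pow_two, e0]
    simp only [e1, mul_pow, e2] at this
    rwa [lintegral_sub_left_eq_self k1 τ] at this
  have hA' : ∫⁻ τ, (∫⁻ σ, k1 (τ - σ) * w σ) ^ 2 ≤ (∫⁻ a, k1 a) ^ 2 * ∫⁻ a, w a ^ 2 := by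
    calc _ ≤ ∫⁻ τ, (∫⁻ a, k1 a) * ∫⁻ σ, k1 (τ - σ) * w σ ^ 2 := lintegral_mono hA
      _ = (∫⁻ a, k1 a) * ∫⁻ τ, ∫⁻ σ, k1 (τ - σ) * w σ ^ 2 := by
        rw [lintegral_const_mul]
        exact Measurable.lintegral_prod_right' (f := fun p : ℝ × ℝ => k1 (p.1 - p.2) * w p.2 ^ 2)
          (by fun_prop)
      _ = (∫⁻ a, k1 a) * ∫⁻ σ, ∫⁻ τ, k1 (τ - σ) * w σ ^ 2 := by
        rw [lintegral_lintegral_swap]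
        exact Measurable.aemeasurable (by fun_prop)
      _ = (∫⁻ a, k1 a) * ∫⁻ σ, (∫⁻ a, k1 a) * w σ ^ 2 := by
        congr 2; ext σ
        rw [lintegral_mul_const _ (by fun_prop), lintegral_sub_right_eq_self k1 σ]
      _ = _ := by
        rw [lintegral_const_mul _ (by fun_prop)]; ring
  have hB : ∀ τ, (∫⁻ σ, k2 τ * k3 σ * w σ) ^ 2 ≤ k2 τ ^ 2 * ((∫⁻ a, k3 a ^ 2) * ∫⁻ a, w a ^ 2) := by
    intro τ
    simp only [mul_assoc]
    rw [lintegral_const_mul _ (by fun_prop), mul_pow]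
    gcongr
    exact cs k3 w h3 hw
  have hsq : ∀ x y : ENNReal, (x + y) ^ 2 ≤ 4 * (x ^ 2 + y ^ 2) := by
    intro x y
    rcases le_total x y with h | h
    · calc (x + y) ^ 2 ≤ (y + y) ^ 2 := by gcongr
        _ = 4 * (0 + y ^ 2) := by ring
        _ ≤ _ := by gcongr; exact zero_le
    · calc (x + y) ^ 2 ≤ (x + x) ^ 2 := by gcongr
        _ = 4 * (x ^ 2 + 0) := by ring
        _ ≤ _ := by gcongr; exact zero_le
  calc _ ≤ ∫⁻ τ, 4 * ((∫⁻ σ, k1 (τ - σ) * w σ) ^ 2 + k2 τ ^ 2 * ((∫⁻ a, k3 a ^ 2) * ∫⁻ a, w a ^ 2)) := by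
        refine lintegral_mono fun τ => ?_
        simp only [add_mul]
        rw [lintegral_add_left (by fun_prop)]
        refine (hsq _ _).trans ?_
        gcongr
        exact hB τ
    _ = 4 * (∫⁻ τ, (∫⁻ σ, k1 (τ - σ) * w σ) ^ 2) + 4 * ((∫⁻ τ, k2 τ ^ 2) * ((∫⁻ a, k3 a ^ 2) * ∫⁻ a, w a ^ 2)) := by
        have hm : Measurable fun τ => (∫⁻ σ, k1 (τ - σ) * w σ) ^ 2 :=
          (Measurable.lintegral_prod_right' (f := fun p : ℝ × ℝ => k1 (p.1 - p.2) * w p.2)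
            (by fun_prop)).pow_const 2
        rw [lintegral_const_mul _ (by fun_prop), lintegral_add_left hm,
          lintegral_mul_const _ (by fun_prop), mul_add]
    _ ≤ 4 * ((∫⁻ a, k1 a) ^ 2 * ∫⁻ a, w a ^ 2) + 4 * ((∫⁻ τ, k2 τ ^ 2) * ((∫⁻ a, k3 a ^ 2) * ∫⁻ a, w a ^ 2)) := by
        gcongr
    _ = _ := by ring

/-- Fubini over the Duhamel region. -/
lemma fub (a : ℝ → ℂ) (ha : Continuous a) (hac : HasCompactSupport a) (P : ℝ → ℝ → ℝ → ℂ)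
    (hP : Continuous fun p : ℝ × ℝ × ℝ => P p.1 p.2.1 p.2.2) (B : ℝ → ℝ) (M : ℝ)
    (hB : Integrable B) (hBM : ∀ ξ, B ξ ≤ M) (hPB : ∀ t t' ξ, ‖P t t' ξ‖ ≤ B ξ) :
    (∫ t, a t * ∫ t' in (0:ℝ)..t, ∫ ξ, P t t' ξ) = (∫ ξ, ∫ t, a t * ∫ t' in (0:ℝ)..t, P t t' ξ) ∧
    Integrable (fun ξ => ∫ t, a t * ∫ t' in (0:ℝ)..t, P t t' ξ) ∧
    Continuous (fun ξ => ∫ t, a t * ∫ t' in (0:ℝ)..t, P t t' ξ) := by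
  let ν : Measure (ℝ × ℝ) := (volume : Measure ℝ).prod (volume.restrict (Set.Ioc (0:ℝ) 1))
  let Q : ℝ × ℝ → ℝ → ℂ := fun z ξ => a z.1 * z.1 * P z.1 (z.1 * z.2) ξ
  have hQ : Continuous (Function.uncurry Q) := by
    have h1 : Continuous fun y : (ℝ × ℝ) × ℝ => P y.1.1 (y.1.1 * y.1.2) y.2 :=
      hP.comp (g := fun p : ℝ × ℝ × ℝ => P p.1 p.2.1 p.2.2)
        (f := fun y : (ℝ × ℝ) × ℝ => (y.1.1, y.1.1 * y.1.2, y.2)) (by fun_prop)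
    have h2 : Continuous fun y : (ℝ × ℝ) × ℝ => a y.1.1 * (y.1.1 : ℂ) := by fun_prop
    exact h2.mul h1
  have hA : Integrable (fun t : ℝ => a t * t) :=
    Continuous.integrable_of_hasCompactSupport (by fun_prop) hac.mul_right
  have hA2 : Integrable (fun z : ℝ × ℝ => a z.1 * z.1) ν := by
    have := hA.mul_prod (ν := volume.restrict (Set.Ioc (0:ℝ) 1)) (g := fun _ => (1:ℂ))
      (integrable_const 1)
    simpa using this
  have hbound : ∀ z ξ, ‖Q z ξ‖ ≤ ‖a z.1 * z.1‖ * B ξ := by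
    intro z ξ
    simp only [Q]
    rw [norm_mul]
    gcongr
    exact hPB _ _ _
  have hQi : Integrable (Function.uncurry Q) (ν.prod volume) := by
    refine Integrable.mono' (hA2.norm.mul_prod hB) hQ.aestronglyMeasurable ?_
    exact Filter.Eventually.of_forall fun y => hbound y.1 y.2
  have sub : ∀ (p : ℝ → ℂ) (t : ℝ), (a t * ∫ t' in (0:ℝ)..t, p t') =
      ∫ u in Set.Ioc (0:ℝ) 1, a t * t * p (t * u) := by
    intro p t
    rw [integral_const_mul, ← intervalIntegral.integral_of_le zero_le_one]
    have := intervalIntegral.smul_integral_comp_mul_left (a := 0) (b := 1) p t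
    simp only [mul_zero, mul_one] at this
    rw [← this, Complex.real_smul, mul_assoc]
  have hQz : ∀ ξ, Integrable (fun z => Q z ξ) ν := by
    intro ξ
    refine Integrable.mono' (hA2.norm.mul_const (B ξ))
      (Continuous.aestronglyMeasurable (hQ.comp (by fun_prop : Continuous fun z : ℝ × ℝ => (z, ξ)))) ?_
    exact Filter.Eventually.of_forall fun z => hbound z ξ
  have eH : (fun ξ => ∫ t, a t * ∫ t' in (0:ℝ)..t, P t t' ξ) = fun ξ => ∫ z, Q z ξ ∂ν := by
    ext ξ
    rw [integral_prod _ (hQz ξ)]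
    congr 1; ext t
    exact sub (fun t' => P t t' ξ) t
  rw [eH]
  refine ⟨?_, hQi.integral_prod_right, ?_⟩
  · rw [← integral_integral_swap hQi]
    have h5 := integral_prod (fun z => ∫ y, Q z y) hQi.integral_prod_left
    refine Eq.trans ?_ h5.symm
    congr 1; ext t
    rw [sub (fun t' => ∫ ξ, P t t' ξ) t]
    congr 1; ext u
    simp only [Q]
    rw [integral_const_mul]
  · refine continuous_of_dominated (bound := fun z => ‖a z.1 * z.1‖ * M)
      (fun ξ => (hQz ξ).aestronglyMeasurable) ?_ (hA2.norm.mul_const M) ?_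
    · exact fun ξ => Filter.Eventually.of_forall fun z => (hbound z ξ).trans (by gcongr; exact hBM ξ)
    · exact Filter.Eventually.of_forall fun z => hQ.comp (by fun_prop : Continuous fun ξ : ℝ => (z, ξ))

lemma psi_schwartz (η : ℝ → ℂ) (h1 : ContDiff ℝ (⊤ : ℕ∞) η)
    (h2 : Function.support η ⊆ Set.Icc (-1 : ℝ) 1) :
    ∃ S : SchwartzMap ℝ ℂ, ∀ τ, (∫ t : ℝ, ex (-(t * τ)) * η t) = S τ := by
  have hc : HasCompactSupport η := HasCompactSupport.of_support_subset_isCompact isCompact_Icc h2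
  have hpi : (2 * π : ℝ)⁻¹ ≠ 0 := by positivity
  let d : ℝ ≃L[ℝ] ℝ := ContinuousLinearEquiv.smulLeft (Units.mk0 ((2 * π : ℝ)⁻¹) hpi)
  let f1 : SchwartzMap ℝ ℂ := hc.toSchwartzMap h1
  let S0 : SchwartzMap ℝ ℂ := FourierTransform.fourier f1
  refine ⟨SchwartzMap.compCLMOfContinuousLinearEquiv ℂ d S0, fun τ => ?_⟩
  have e1 : SchwartzMap.compCLMOfContinuousLinearEquiv ℂ d S0 τ =
      FourierTransform.fourier η ((2 * π : ℝ)⁻¹ * τ) := by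
    have : FourierTransform.fourier η = FourierTransform.fourier (⇑f1) := rfl
    rw [this, ← SchwartzMap.fourier_coe]; rfl
  rw [e1, fourier_eq_ex]
  congr 1; ext t
  congr 3
  field_simp

lemma psi_bound (η : ℝ → ℂ) (h1 : ContDiff ℝ (⊤ : ℕ∞) η)
    (h2 : Function.support η ⊆ Set.Icc (-1 : ℝ) 1) :
    ∃ C > 0, (∀ τ, ‖∫ t : ℝ, ex (-(t * τ)) * η t‖ ≤ C * (1 + |τ|) ^ (-3 : ℝ)) ∧
      ∀ τ σ : ℝ, |σ| ≤ 1 → ‖(∫ t : ℝ, ex (-(t * (τ - σ))) * η t) - ∫ t : ℝ, ex (-(t * τ)) * η t‖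
        ≤ C * |σ| * (1 + |τ|) ^ (-3 : ℝ) := by
  obtain ⟨S, hS⟩ := psi_schwartz η h1 h2
  simp only [hS]
  have dec : ∀ F : SchwartzMap ℝ ℂ, ∃ C ≥ 0, ∀ x, ‖F x‖ ≤ C * (1 + |x|) ^ (-3 : ℝ) := by
    intro F
    refine ⟨2 ^ 3 * ((Finset.Iic (3, 0)).sup fun m => SchwartzMap.seminorm ℝ m.1 m.2) F,
      by positivity, fun x => ?_⟩
    have := SchwartzMap.one_add_le_sup_seminorm_apply (𝕜 := ℝ) (m := (3, 0)) (k := 3) (n := 0)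
      le_rfl le_rfl F x
    rw [norm_iteratedFDeriv_zero, Real.norm_eq_abs] at this
    rw [Real.rpow_neg (by positivity), ← div_eq_mul_inv, le_div_iff₀ (by positivity)]
    refine le_trans (le_of_eq ?_) this
    rw [mul_comm]; norm_cast
  obtain ⟨C0, hC0, hb0⟩ := dec S
  obtain ⟨C1, hC1, hb1⟩ := dec (SchwartzMap.derivCLM ℝ ℂ S)
  refine ⟨C0 + 8 * C1 + 1, by positivity, fun τ => ?_, fun τ σ hσ => ?_⟩
  · refine (hb0 τ).trans ?_
    gcongr; linarith
  · have hmv := Convex.norm_image_sub_le_of_norm_deriv_le (f := ⇑S) (s := Metric.closedBall τ 1)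
      (x := τ) (y := τ - σ) (C := 8 * C1 * (1 + |τ|) ^ (-3 : ℝ))
      (fun x _ => S.differentiableAt) ?_ (convex_closedBall _ _) (by simp) (by simpa using hσ)
    · refine hmv.trans ?_
      have : ‖τ - σ - τ‖ = |σ| := by simp
      rw [this]
      have h3 : (0:ℝ) ≤ (1 + |τ|) ^ (-3 : ℝ) := by positivity
      have h4 : 0 ≤ |σ| * (1 + |τ|) ^ (-3 : ℝ) := by positivity
      nlinarith
    · intro x hx
      have h5 := hb1 x
      rw [SchwartzMap.derivCLM_apply] at h5
      refine h5.trans ?_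
      have h6 : 1 + |τ| ≤ 2 * (1 + |x|) := by
        rw [Metric.mem_closedBall, Real.dist_eq] at hx
        have := abs_sub_abs_le_abs_sub τ x
        rw [abs_sub_comm] at this
        linarith [abs_nonneg x]
      have h7 : (1 + |x|) ^ (-3 : ℝ) ≤ 8 * (1 + |τ|) ^ (-3 : ℝ) := by
        have h8 := Real.rpow_le_rpow_of_nonpos (z := -3) (by positivity) h6 (by norm_num)
        rw [Real.mul_rpow (by norm_num) (by positivity)] at h8
        have h9 : (2:ℝ) ^ (-3:ℝ) = 1 / 8 := by
          rw [Real.rpow_neg (by norm_num)]; norm_num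
        rw [h9] at h8
        linarith
      nlinarith

/-- The Duhamel kernel in frequency variables. -/
noncomputable def Mk (η : ℝ → ℂ) (T τ σ : ℝ) : ℂ :=
  ∫ t, (ex (-(t * τ)) * η (t / T)) * ∫ t' in (0:ℝ)..t, ex (t' * σ)

lemma int_ex (σ : ℝ) (hσ : σ ≠ 0) (t : ℝ) :
    ∫ t' in (0:ℝ)..t, ex (t' * σ) = (Complex.I * σ)⁻¹ * (ex (t * σ) - 1) := by
  have hc : (Complex.I * σ) ≠ 0 := mul_ne_zero Complex.I_ne_zero (by exact_mod_cast hσ)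
  have := integral_exp_mul_complex (a := 0) (b := t) hc
  have e : (fun t' : ℝ => ex (t' * σ)) = fun t' : ℝ => Complex.exp (Complex.I * σ * t') := by
    ext t'; simp only [ex]; congr 1; push_cast; ring
  rw [e, this, ex]
  simp only [Complex.ofReal_zero, mul_zero, Complex.exp_zero]
  rw [div_eq_inv_mul]
  congr 3; push_cast; ring

lemma Mk_eq (η : ℝ → ℂ) (h1 : Continuous η) (h2 : HasCompactSupport η) (T : ℝ) (hT : 0 < T)
    (τ σ : ℝ) (hσ : σ ≠ 0) :
    Mk η T τ σ = (Complex.I * σ)⁻¹ * (T * ((∫ t : ℝ, ex (-(t * (T * τ - T * σ))) * η t) -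
      ∫ t : ℝ, ex (-(t * (T * τ))) * η t)) := by
  unfold Mk
  have hi : ∀ r : ℝ, Integrable fun t : ℝ => ex (-(t * r)) * η (t / T) := by
    intro r
    refine Continuous.integrable_of_hasCompactSupport (by fun_prop) ?_
    refine HasCompactSupport.mul_left ?_
    have := h2.comp_homeomorph (Homeomorph.mulRight₀ (T⁻¹) (by positivity))
    simpa [Function.comp_def, div_eq_mul_inv] using this
  have hsc : ∀ r : ℝ, ∫ t : ℝ, ex (-(t * r)) * η (t / T) =
      T * ∫ t : ℝ, ex (-(t * (T * r))) * η t := by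
    intro r
    have := Measure.integral_comp_div (fun t : ℝ => ex (-(t * (T * r))) * η t) T
    rw [abs_of_pos hT, Complex.real_smul] at this
    rw [← this]
    congr 1; ext t
    congr 3; field_simp
  have e1 : (fun t => (ex (-(t * τ)) * η (t / T)) * ∫ t' in (0:ℝ)..t, ex (t' * σ)) =
      fun t => (Complex.I * σ)⁻¹ * (ex (-(t * (τ - σ))) * η (t / T) - ex (-(t * τ)) * η (t / T)) := by
    ext t
    have e2 : ex (-(t * (τ - σ))) = ex (-(t * τ)) * ex (t * σ) := by
      rw [← ex_add]; congr 1; ring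
    rw [int_ex σ hσ, e2]; ring
  rw [e1, integral_const_mul, integral_sub (hi _) (hi _), hsc, hsc, mul_sub T τ σ]
  ring

lemma weight_bound (b b' x y : ℝ) (_hb'2 : b' ≤ 0) (hb0 : 0 ≤ b)
    (hb1 : b ≤ b' + 1) :
    (1 + |y|)⁻¹ * ((1 + |x - y|) ^ (-3 : ℝ) + (1 + |x|) ^ (-3 : ℝ)) *
      ((1 + |x|) ^ b * (1 + |y|) ^ (-b')) ≤
    (1 + |x - y|) ^ (-2 : ℝ) + (1 + |x|) ^ (-2 : ℝ) * (1 + |y|) ^ (-b' - 1) := by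
  have px : 0 < 1 + |x| := by positivity
  have py : 0 < 1 + |y| := by positivity
  have pz : 0 < 1 + |x - y| := by positivity
  have hxy : 1 + |x| ≤ (1 + |y|) * (1 + |x - y|) := by
    have : |x| ≤ |y| + |x - y| := by
      have := abs_add_le y (x - y); simpa using this
    nlinarith [abs_nonneg y, abs_nonneg (x - y)]
  have hy : (1 + |y|)⁻¹ * (1 + |y|) ^ (-b') = (1 + |y|) ^ (-b' - 1) := by
    rw [Real.rpow_sub_one py.ne']; field_simp
  have A : (1 + |x|) ^ b * (1 + |y|) ^ (-b' - 1) * (1 + |x - y|) ^ (-3 : ℝ) ≤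
      (1 + |x - y|) ^ (-2 : ℝ) := by
    calc _ ≤ ((1 + |y|) * (1 + |x - y|)) ^ b * (1 + |y|) ^ (-b' - 1) * (1 + |x - y|) ^ (-3 : ℝ) := by
          gcongr
      _ = (1 + |y|) ^ (b + (-b' - 1)) * (1 + |x - y|) ^ (b + -3) := by
          rw [Real.mul_rpow py.le pz.le, Real.rpow_add py, Real.rpow_add pz]; ring
      _ ≤ 1 * (1 + |x - y|) ^ (-2 : ℝ) := by
          gcongr
          · exact Real.rpow_le_one_of_one_le_of_nonpos (by linarith [abs_nonneg y]) (by linarith)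
          · linarith [abs_nonneg (x - y)]
          · linarith
      _ = _ := one_mul _
  have B : (1 + |x|) ^ b * (1 + |x|) ^ (-3 : ℝ) ≤ (1 + |x|) ^ (-2 : ℝ) := by
    rw [← Real.rpow_add px]
    exact Real.rpow_le_rpow_of_exponent_le (by linarith [abs_nonneg x]) (by linarith)
  calc _ = (1 + |x|) ^ b * (1 + |y|) ^ (-b' - 1) * (1 + |x - y|) ^ (-3 : ℝ) +
        (1 + |x|) ^ b * (1 + |x|) ^ (-3 : ℝ) * (1 + |y|) ^ (-b' - 1) := by rw [← hy]; ring
    _ ≤ _ := by gcongr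

lemma Mk_bound (b b' : ℝ) (hb'2 : b' ≤ 0) (hb0 : 0 ≤ b)
    (hb1 : b ≤ b' + 1) (η : ℝ → ℂ) (h1 : ContDiff ℝ (⊤ : ℕ∞) η)
    (h2 : Function.support η ⊆ Set.Icc (-1 : ℝ) 1) :
    ∃ C > 0, ∀ T ∈ Set.Ioc (0:ℝ) 1, ∀ τ σ : ℝ, σ ≠ 0 →
      ‖Mk η T τ σ‖ * ((1 + |τ|) ^ b * (1 + |σ|) ^ (-b')) ≤
      C * T ^ (2 - b + b') * ((1 + |T * (τ - σ)|) ^ (-2 : ℝ) +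
        (1 + |T * τ|) ^ (-2 : ℝ) * (1 + |T * σ|) ^ (-b' - 1)) := by
  have hc : HasCompactSupport η := HasCompactSupport.of_support_subset_isCompact isCompact_Icc h2
  obtain ⟨C, hC, hb, hd⟩ := psi_bound η h1 h2
  refine ⟨2 * C, by positivity, ?_⟩
  rintro T ⟨hT, hT1⟩ τ σ hσ
  rw [Mk_eq η h1.continuous hc T hT τ σ hσ]
  set ψ : ℝ → ℂ := fun τ => ∫ t : ℝ, ex (-(t * τ)) * η t with hψ
  change ‖(Complex.I * σ)⁻¹ * (T * (ψ (T * τ - T * σ) - ψ (T * τ)))‖ * _ ≤ _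
  have hy0 : 0 < |T * σ| := abs_pos.mpr (mul_ne_zero hT.ne' hσ)
  have hn : ‖(Complex.I * σ)⁻¹ * (T * (ψ (T * τ - T * σ) - ψ (T * τ)))‖ =
      T ^ 2 * (|T * σ|⁻¹ * ‖ψ (T * τ - T * σ) - ψ (T * τ)‖) := by
    have : 0 < |σ| := abs_pos.mpr hσ
    rw [norm_mul, norm_inv, norm_mul, norm_mul, Complex.norm_I, Complex.norm_real,
      Complex.norm_real, Real.norm_eq_abs, Real.norm_eq_abs, abs_mul, abs_of_pos hT]
    field_simp
  set x := T * τ with hx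
  set y := T * σ with hy
  have hxy : T * (τ - σ) = x - y := by rw [hx, hy]; ring
  rw [hn, hxy]
  have px : 0 < 1 + |x| := by positivity
  have py : 0 < 1 + |y| := by positivity
  have pz : 0 < 1 + |x - y| := by positivity
  have main : |y|⁻¹ * ‖ψ (x - y) - ψ x‖ ≤
      2 * C * ((1 + |y|)⁻¹ * ((1 + |x - y|) ^ (-3 : ℝ) + (1 + |x|) ^ (-3 : ℝ))) := by
    have p1 : 0 ≤ (1 + |x|) ^ (-3 : ℝ) := by positivity
    have p2 : 0 ≤ (1 + |x - y|) ^ (-3 : ℝ) := by positivity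
    rw [inv_mul_le_iff₀ hy0]
    rcases le_total |y| 1 with h | h
    · refine (hd x y h).trans ?_
      have : 1 ≤ 2 * (1 + |y|)⁻¹ := by
        rw [← div_eq_mul_inv, le_div_iff₀ py]; linarith
      calc C * |y| * (1 + |x|) ^ (-3 : ℝ) = 1 * (C * |y| * (0 + (1 + |x|) ^ (-3 : ℝ))) := by ring
        _ ≤ (2 * (1 + |y|)⁻¹) * (C * |y| * ((1 + |x - y|) ^ (-3 : ℝ) + (1 + |x|) ^ (-3 : ℝ))) := by
          gcongr
        _ = _ := by ring
    · refine (norm_sub_le _ _).trans ((add_le_add (hb _) (hb _)).trans ?_)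
      have : 1 ≤ |y| * (2 * (1 + |y|)⁻¹) := by
        rw [← mul_assoc, ← div_eq_mul_inv, le_div_iff₀ py]; linarith
      calc _ = 1 * (C * ((1 + |x - y|) ^ (-3 : ℝ) + (1 + |x|) ^ (-3 : ℝ))) := by ring
        _ ≤ |y| * (2 * (1 + |y|)⁻¹) * (C * ((1 + |x - y|) ^ (-3 : ℝ) + (1 + |x|) ^ (-3 : ℝ))) := by
          gcongr
        _ = _ := by ring
  have sc : ∀ (r p : ℝ), 0 ≤ p → (1 + |r|) ^ p ≤ T ^ (-p) * (1 + |T * r|) ^ p := by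
    intro r p hp
    rw [Real.rpow_neg hT.le, ← div_eq_inv_mul, le_div_iff₀ (by positivity),
      ← Real.mul_rpow (by positivity) hT.le]
    gcongr
    rw [abs_mul, abs_of_pos hT]; linarith [abs_nonneg r]
  have s1 := sc τ b hb0
  have s2 := sc σ (-b') (by linarith)
  rw [neg_neg] at s2
  have hw := weight_bound b b' x y hb'2 hb0 hb1
  have hTp : T ^ (2 - b + b') = T ^ 2 * T ^ (-b) * T ^ b' := by
    rw [sub_eq_add_neg, Real.rpow_add hT, Real.rpow_add hT]; norm_cast
  rw [hTp]
  calc _ ≤ T ^ 2 * (2 * C * ((1 + |y|)⁻¹ * ((1 + |x - y|) ^ (-3 : ℝ) + (1 + |x|) ^ (-3 : ℝ)))) *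
        ((T ^ (-b) * (1 + |x|) ^ b) * (T ^ b' * (1 + |y|) ^ (-b'))) := by
        gcongr
    _ = 2 * C * (T ^ 2 * T ^ (-b) * T ^ b') * ((1 + |y|)⁻¹ * ((1 + |x - y|) ^ (-3 : ℝ) + (1 + |x|) ^ (-3 : ℝ)) *
      ((1 + |x|) ^ b * (1 + |y|) ^ (-b'))) := by ring
    _ ≤ _ := by gcongr

lemma brak_meas (T r : ℝ) : Measurable fun a : ℝ => (1 + |T * a|) ^ r := by
  have : Continuous fun a : ℝ => (1 + |T * a|) ^ r := by
    refine Continuous.rpow_const (by fun_prop) fun a => Or.inl ?_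
    positivity
  exact this.measurable

lemma brak_lint (T r : ℝ) (hT : 0 < T) (hr : 1 < r) :
    ∫⁻ a : ℝ, ENNReal.ofReal ((1 + |T * a|) ^ (-r)) =
      ENNReal.ofReal (T⁻¹ * ∫ a : ℝ, (1 + |a|) ^ (-r)) := by
  have hi : Integrable fun a : ℝ => (1 + |a|) ^ (-r) := by
    have := integrable_one_add_norm (E := ℝ) (μ := volume) (r := r) (by simpa using hr)
    simpa using this
  have h1 := hi.comp_mul_left' hT.ne'
  rw [← ofReal_integral_eq_lintegral_ofReal h1
    (Filter.Eventually.of_forall fun a => by positivity)]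
  rw [Measure.integral_comp_mul_left (fun a : ℝ => (1 + |a|) ^ (-r)) T, abs_of_pos (by positivity),
    smul_eq_mul]

lemma oneD (b b' : ℝ) (hb'1 : -(1 / 2 : ℝ) < b') (hb'2 : b' ≤ 0) (hb0 : 0 ≤ b)
    (hb1 : b ≤ b' + 1) (η : ℝ → ℂ) (h1 : ContDiff ℝ (⊤ : ℕ∞) η)
    (h2 : Function.support η ⊆ Set.Icc (-1 : ℝ) 1) :
    ∃ C > 0, ∀ T ∈ Set.Ioc (0:ℝ) 1, ∀ G : ℝ → ℂ, Continuous G →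
      Integrable (fun σ => (1 + |σ|) ^ (2 * b') * ‖G σ‖ ^ 2) →
      ∀ Φ : ℝ → ℝ, (∀ τ, 0 ≤ Φ τ) → (∀ τ, Φ τ ≤ ‖∫ σ, Mk η T τ σ * G σ‖) →
      ∫ τ : ℝ, (1 + |τ|) ^ (2 * b) * Φ τ ^ 2 ≤
        C * (T ^ (1 - b + b')) ^ 2 * ∫ σ : ℝ, (1 + |σ|) ^ (2 * b') * ‖G σ‖ ^ 2 := by
  obtain ⟨C0, hC0, hM⟩ := Mk_bound b b' hb'2 hb0 hb1 η h1 h2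
  set c2 := ∫ a : ℝ, (1 + |a|) ^ (-2 : ℝ) with hc2
  set c4 := ∫ a : ℝ, (1 + |a|) ^ (-4 : ℝ) with hc4
  set c3 := ∫ a : ℝ, (1 + |a|) ^ (-(2 * b' + 2)) with hc3
  have c2n : 0 ≤ c2 := integral_nonneg fun a => by positivity
  have c3n : 0 ≤ c3 := integral_nonneg fun a => by positivity
  have c4n : 0 ≤ c4 := integral_nonneg fun a => by positivity
  refine ⟨4 * (c2 ^ 2 + c4 * c3) * C0 ^ 2 + 1, by positivity, ?_⟩
  rintro T ⟨hT, hT1⟩ G hG hGi Φ hΦ0 hΦ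
  set I := ∫ σ : ℝ, (1 + |σ|) ^ (2 * b') * ‖G σ‖ ^ 2 with hI
  have In : 0 ≤ I := integral_nonneg fun a => by positivity
  by_cases hintg : Integrable fun τ : ℝ => (1 + |τ|) ^ (2 * b) * Φ τ ^ 2
  swap
  · rw [integral_undef hintg]; positivity
  set D := C0 * T ^ (2 - b + b') with hD
  have Dn : 0 ≤ D := by positivity
  let k1 : ℝ → ENNReal := fun a => ENNReal.ofReal ((1 + |T * a|) ^ (-2 : ℝ))
  let k3 : ℝ → ENNReal := fun a => ENNReal.ofReal ((1 + |T * a|) ^ (-b' - 1))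
  let w : ℝ → ENNReal := fun a => ENNReal.ofReal ((1 + |a|) ^ b' * ‖G a‖)
  have m1 : Measurable k1 := (brak_meas T _).ennreal_ofReal
  have m3 : Measurable k3 := (brak_meas T _).ennreal_ofReal
  have mw : Measurable w := by
    have := brak_meas 1 b'
    simp only [one_mul] at this
    exact (this.mul hG.norm.measurable).ennreal_ofReal
  have pt : ∀ τ, ENNReal.ofReal ((1 + |τ|) ^ (2 * b) * Φ τ ^ 2) ≤
      ENNReal.ofReal D ^ 2 * (∫⁻ σ, (k1 (τ - σ) + k1 τ * k3 σ) * w σ) ^ 2 := by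
    intro τ
    have e1 : (1 + |τ|) ^ (2 * b) * Φ τ ^ 2 =
        ((1 + |τ|) ^ b * Φ τ) ^ 2 := by
      rw [mul_pow, ← Real.rpow_natCast ((1 + |τ|) ^ b), ← Real.rpow_mul (by positivity)]
      norm_num [mul_comm]
    have hp := hΦ0 τ
    rw [e1, ENNReal.ofReal_pow (by positivity), ← mul_pow]
    gcongr
    rw [ENNReal.ofReal_mul (by positivity)]
    have hp2 : ENNReal.ofReal (Φ τ) ≤ ‖∫ σ, Mk η T τ σ * G σ‖ₑ := by
      rw [← ofReal_norm]; exact ENNReal.ofReal_le_ofReal (hΦ τ)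
    calc _ ≤ ENNReal.ofReal ((1 + |τ|) ^ b) * ∫⁻ σ, ‖Mk η T τ σ * G σ‖ₑ := by
          gcongr; exact hp2.trans <| enorm_integral_le_lintegral_enorm _
      _ = ∫⁻ σ, ENNReal.ofReal ((1 + |τ|) ^ b) * ‖Mk η T τ σ * G σ‖ₑ := by
          rw [lintegral_const_mul' _ _ ENNReal.ofReal_ne_top]
      _ ≤ ∫⁻ σ, ENNReal.ofReal D * ((k1 (τ - σ) + k1 τ * k3 σ) * w σ) := by
          refine lintegral_mono_ae ?_
          have : ∀ᵐ σ : ℝ, σ ≠ 0 := by simp [ae_iff]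
          filter_upwards [this] with σ hσ
          simp only [k1, k3, w]
          rw [← ofReal_norm, ← ENNReal.ofReal_mul (by positivity),
            ← ENNReal.ofReal_mul (by positivity), ← ENNReal.ofReal_add (by positivity) (by positivity),
            ← ENNReal.ofReal_mul (by positivity), ← ENNReal.ofReal_mul (by positivity)]
          refine ENNReal.ofReal_le_ofReal ?_
          have hh := hM T ⟨hT, hT1⟩ τ σ hσ
          have e2 : (1 + |σ|) ^ (-b') * (1 + |σ|) ^ b' = 1 := by
            rw [← Real.rpow_add (by positivity)]; simp
          calc (1 + |τ|) ^ b * ‖Mk η T τ σ * G σ‖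
              = (1 + |τ|) ^ b * ‖Mk η T τ σ‖ * ((1 + |σ|) ^ (-b') * (1 + |σ|) ^ b') * ‖G σ‖ := by
                rw [e2, norm_mul]; ring
            _ = (‖Mk η T τ σ‖ * ((1 + |τ|) ^ b * (1 + |σ|) ^ (-b'))) * ((1 + |σ|) ^ b' * ‖G σ‖) := by
                ring
            _ ≤ _ := by
                refine (mul_le_mul_of_nonneg_right hh (by positivity)).trans (le_of_eq ?_)
                rw [hD]; ring
      _ = _ := lintegral_const_mul' _ _ ENNReal.ofReal_ne_top
  have hsch := schur k1 k1 k3 w m1 m1 m3 mw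
  have i1 : ∫⁻ a, k1 a = ENNReal.ofReal (T⁻¹ * c2) := brak_lint T 2 hT (by norm_num)
  have i2 : ∫⁻ a, k1 a ^ 2 = ENNReal.ofReal (T⁻¹ * c4) := by
    rw [hc4, ← brak_lint T 4 hT (by norm_num)]
    congr 1; ext a
    simp only [k1]
    rw [← ENNReal.ofReal_pow (by positivity), ← Real.rpow_natCast, ← Real.rpow_mul (by positivity)]
    norm_num
  have i3 : ∫⁻ a, k3 a ^ 2 = ENNReal.ofReal (T⁻¹ * c3) := by
    rw [hc3, ← brak_lint T _ hT (by linarith)]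
    congr 1; ext a
    simp only [k3]
    rw [← ENNReal.ofReal_pow (by positivity), ← Real.rpow_natCast, ← Real.rpow_mul (by positivity)]
    congr 2; push_cast; ring
  have iw : ∫⁻ a, w a ^ 2 = ENNReal.ofReal I := by
    rw [hI, ofReal_integral_eq_lintegral_ofReal hGi
      (Filter.Eventually.of_forall fun a => by positivity)]
    congr 1; ext a
    simp only [w]
    rw [← ENNReal.ofReal_pow (by positivity), mul_pow, ← Real.rpow_natCast ((1 + |a|) ^ b'),
      ← Real.rpow_mul (by positivity)]
    congr 3; push_cast; ring
  have fin : ENNReal.ofReal (∫ τ : ℝ, (1 + |τ|) ^ (2 * b) * Φ τ ^ 2) ≤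
      ENNReal.ofReal (D ^ 2 * (4 * ((T⁻¹ * c2) ^ 2 + (T⁻¹ * c4) * (T⁻¹ * c3)) * I)) := by
    rw [ofReal_integral_eq_lintegral_ofReal hintg
      (Filter.Eventually.of_forall fun a => by positivity)]
    calc _ ≤ ∫⁻ τ, ENNReal.ofReal D ^ 2 * (∫⁻ σ, (k1 (τ - σ) + k1 τ * k3 σ) * w σ) ^ 2 :=
          lintegral_mono pt
      _ = ENNReal.ofReal D ^ 2 * ∫⁻ τ, (∫⁻ σ, (k1 (τ - σ) + k1 τ * k3 σ) * w σ) ^ 2 :=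
          lintegral_const_mul' _ _ (by simp)
      _ ≤ _ := by
          refine (mul_le_mul_right hsch _).trans (le_of_eq ?_)
          rw [i1, i2, i3, iw]
          have h4 : (4 : ENNReal) = ENNReal.ofReal 4 := by norm_num
          rw [h4, ← ENNReal.ofReal_pow (by positivity), ← ENNReal.ofReal_pow (by positivity),
            ← ENNReal.ofReal_mul (by positivity), ← ENNReal.ofReal_add (by positivity) (by positivity),
            ← ENNReal.ofReal_mul (by positivity), ← ENNReal.ofReal_mul (by positivity),
            ← ENNReal.ofReal_mul (by positivity)]
  have fin2 := (ENNReal.ofReal_le_ofReal_iff (by positivity)).mp fin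
  refine fin2.trans ?_
  have hTp : T ^ (2 - b + b') = T * T ^ (1 - b + b') := by
    rw [show 2 - b + b' = 1 + (1 - b + b') by ring, Real.rpow_add hT, Real.rpow_one]
  have e3 : D ^ 2 * (4 * ((T⁻¹ * c2) ^ 2 + (T⁻¹ * c4) * (T⁻¹ * c3)) * I) =
      (4 * (c2 ^ 2 + c4 * c3) * C0 ^ 2) * (T ^ (1 - b + b')) ^ 2 * I := by
    rw [hD, hTp]; field_simp
  rw [e3]
  gcongr
  linarith

lemma sch_bound (S : SchwartzMap (ℝ × ℝ) ℂ) (k : ℕ) :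
    ∃ C ≥ 0, ∀ ξ τ : ℝ, ‖S (ξ, τ)‖ ≤ C * ((1 + |ξ|) ^ (-(k : ℝ)) * (1 + |τ|) ^ (-2 : ℝ)) := by
  refine ⟨2 ^ (k + 2) * ((Finset.Iic (k + 2, 0)).sup fun m => SchwartzMap.seminorm ℝ m.1 m.2) S,
      by positivity, fun ξ τ => ?_⟩
  have := SchwartzMap.one_add_le_sup_seminorm_apply (𝕜 := ℝ) (m := (k + 2, 0)) (k := k + 2) (n := 0)
      le_rfl le_rfl S (ξ, τ)
  rw [norm_iteratedFDeriv_zero] at this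
  rw [Real.rpow_neg (by positivity), Real.rpow_neg (by positivity), ← mul_inv, ← div_eq_mul_inv,
    le_div_iff₀ (by positivity)]
  refine le_trans ?_ this
  rw [mul_comm, pow_add]
  have h1 : |ξ| ≤ ‖((ξ, τ) : ℝ × ℝ)‖ := norm_fst_le (ξ, τ)
  have h2 : |τ| ≤ ‖((ξ, τ) : ℝ × ℝ)‖ := norm_snd_le (ξ, τ)
  have e1 : (1 + |ξ|) ^ (k : ℝ) = (1 + |ξ|) ^ k := Real.rpow_natCast _ _
  have e2 : (1 + |τ|) ^ (2 : ℝ) = (1 + |τ|) ^ 2 := by norm_cast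
  rw [e1, e2]
  gcongr

lemma brak_int : Integrable fun a : ℝ => (1 + |a|) ^ (-2 : ℝ) := by
  have := integrable_one_add_norm (E := ℝ) (μ := volume) (r := 2) (by simp)
  simpa using this

lemma brak_le_one (a r : ℝ) (hr : 0 ≤ r) : (1 + |a|) ^ (-r) ≤ 1 :=
  Real.rpow_le_one_of_one_le_of_nonpos (by linarith [abs_nonneg a]) (by linarith)

lemma sch_bound0 (S : SchwartzMap (ℝ × ℝ) ℂ) :
    ∃ C ≥ 0, (∀ ξ τ : ℝ, ‖S (ξ, τ)‖ ≤ C * (1 + |τ|) ^ (-2 : ℝ)) ∧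
      (∀ ξ τ : ℝ, ‖S (ξ, τ)‖ ≤ C * (1 + |ξ|) ^ (-2 : ℝ)) ∧
      ∀ ξ τ : ℝ, ‖S (ξ, τ)‖ ≤ C * ((1 + |ξ|) ^ (-2 : ℝ) * (1 + |τ|) ^ (-2 : ℝ)) := by
  obtain ⟨C, hC, h⟩ := sch_bound S 2
  have h' : ∀ ξ τ : ℝ, ‖S (ξ, τ)‖ ≤ C * ((1 + |ξ|) ^ (-2 : ℝ) * (1 + |τ|) ^ (-2 : ℝ)) := by
    intro ξ τ
    have := h ξ τ
    push_cast at this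
    exact this
  refine ⟨C, hC, fun ξ τ => (h' ξ τ).trans ?_, fun ξ τ => (h' ξ τ).trans ?_, h'⟩
  · gcongr
    exact mul_le_of_le_one_left (by positivity) (brak_le_one _ _ (by norm_num))
  · gcongr
    exact mul_le_of_le_one_right (by positivity) (brak_le_one _ _ (by norm_num))

lemma sch_slice (S : SchwartzMap (ℝ × ℝ) ℂ) (ξ : ℝ) : Integrable fun τ => S (ξ, τ) := by
  obtain ⟨C, hC, h, -, -⟩ := sch_bound0 S
  exact Integrable.mono' (brak_int.const_mul C) (Continuous.aestronglyMeasurable (by fun_prop))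
    (Filter.Eventually.of_forall fun τ => h ξ τ)

lemma FT2_ex (f : ℝ → ℝ → ℂ) (ξ τ : ℝ) :
    FT2 f ξ τ = ((2 * π : ℝ) : ℂ)⁻¹ * ∫ x : ℝ, ∫ t : ℝ, ex (-(x * ξ + t * τ)) * f x t := by
  unfold FT2
  congr 2; ext x; congr 1; ext t
  simp only [ex]; congr 2; push_cast; ring

lemma FT1_inv (f S : SchwartzMap (ℝ × ℝ) ℂ)
    (hS : ∀ ξ τ, FT2 (fun x t => f (x, t)) ξ τ = S (ξ, τ)) (ξ t : ℝ) :
    FT1 (fun y => f (y, t)) ξ = (Real.sqrt (2 * π) : ℂ)⁻¹ * ∫ τ : ℝ, ex (t * τ) * S (ξ, τ) := by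
  have hpi : ((2 * π : ℝ) : ℂ) ≠ 0 := by exact_mod_cast (by positivity : (2 * π : ℝ) ≠ 0)
  obtain ⟨C, hC, -, hb, hb2⟩ := sch_bound0 f
  let h : ℝ → ℂ := fun t => ∫ x : ℝ, ex (-(x * ξ)) * f (x, t)
  have hh : FT1 (fun y => f (y, t)) ξ = (Real.sqrt (2 * π) : ℂ)⁻¹ * h t := by
    unfold FT1
    congr 2; ext x; congr 1
    simp only [ex]; congr 1; push_cast; ring
  have hintg : ∀ τ : ℝ, Integrable (Function.uncurry fun x t : ℝ => ex (-(x * ξ + t * τ)) * f (x, t))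
      ((volume : Measure ℝ).prod volume) := by
    intro τ
    refine Integrable.mono' ((brak_int.mul_prod brak_int).const_mul C)
      (Continuous.aestronglyMeasurable ?_) (Filter.Eventually.of_forall fun p => ?_)
    · have : Continuous fun p : ℝ × ℝ => ex (-(p.1 * ξ + p.2 * τ)) * f p := by fun_prop
      exact this
    · simp only [Function.uncurry]
      rw [norm_mul, ex_norm, one_mul]
      exact hb2 _ _
  have hc : Continuous h := by
    refine continuous_of_dominated (bound := fun x => C * (1 + |x|) ^ (-2 : ℝ)) ?_ ?_
      (brak_int.const_mul C) ?_
    · exact fun t => Continuous.aestronglyMeasurable (by fun_prop)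
    · refine fun t => Filter.Eventually.of_forall fun x => ?_
      rw [norm_mul, ex_norm, one_mul]
      exact hb _ _
    · exact Filter.Eventually.of_forall fun x => by fun_prop
  have hi : Integrable h := by
    have := (hintg 0).integral_prod_right
    simpa [Function.uncurry, h] using this
  have hF : ∀ τ, ∫ t : ℝ, ex (-(t * τ)) * h t = (2 * π : ℝ) * S (ξ, τ) := by
    intro τ
    rw [← hS, FT2_ex, ← mul_assoc, mul_inv_cancel₀ hpi, one_mul, integral_integral_swap (hintg τ)]
    congr 1; ext t
    simp only [h]
    rw [← integral_const_mul]
    congr 1; ext x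
    rw [← mul_assoc, ← ex_add]; congr 2; ring
  have key := inv1 h hc hi (by simpa only [hF] using (sch_slice S ξ).const_mul _) t
  simp only [hF] at key
  rw [hh]
  congr 1
  have e : ∀ τ : ℝ, ex (t * τ) * (((2 * π : ℝ) : ℂ) * S (ξ, τ)) =
      ((2 * π : ℝ) : ℂ) * (ex (t * τ) * S (ξ, τ)) := fun τ => by ring
  simp only [e] at key
  rw [integral_const_mul] at key
  exact (mul_left_cancel₀ hpi key).symm

lemma Fh_cont (S : SchwartzMap (ℝ × ℝ) ℂ) :
    Continuous fun p : ℝ × ℝ => (Real.sqrt (2 * π) : ℂ)⁻¹ * ∫ τ : ℝ, ex (p.2 * τ) * S (p.1, τ) := by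
  obtain ⟨C, hC, hb, -, -⟩ := sch_bound0 S
  refine continuous_const.mul ?_
  refine continuous_of_dominated (bound := fun x => C * (1 + |x|) ^ (-2 : ℝ)) ?_ ?_
      (brak_int.const_mul C) ?_
  · exact fun t => Continuous.aestronglyMeasurable (by fun_prop)
  · refine fun t => Filter.Eventually.of_forall fun x => ?_
    rw [norm_mul, ex_norm, one_mul]
    exact hb _ _
  · exact Filter.Eventually.of_forall fun x => by fun_prop

lemma Fh_bound (S : SchwartzMap (ℝ × ℝ) ℂ) :
    ∃ C ≥ 0, ∀ ξ t : ℝ, ‖(Real.sqrt (2 * π) : ℂ)⁻¹ * ∫ τ : ℝ, ex (t * τ) * S (ξ, τ)‖ ≤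
      C * (1 + |ξ|) ^ (-2 : ℝ) := by
  obtain ⟨C, hC, -, -, hb⟩ := sch_bound0 S
  refine ⟨‖(Real.sqrt (2 * π) : ℂ)⁻¹‖ * (C * ∫ a : ℝ, (1 + |a|) ^ (-2 : ℝ)), ?_, fun ξ t => ?_⟩
  · have : 0 ≤ ∫ a : ℝ, (1 + |a|) ^ (-2 : ℝ) := integral_nonneg fun a => by positivity
    positivity
  · rw [norm_mul, mul_assoc]
    gcongr
    refine (norm_integral_le_of_norm_le (brak_int.const_mul (C * (1 + |ξ|) ^ (-2 : ℝ)))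
      (Filter.Eventually.of_forall fun τ => ?_)).trans (le_of_eq ?_)
    · rw [norm_mul, ex_norm, one_mul]
      exact (hb _ _).trans (le_of_eq (by ring))
    · rw [integral_const_mul]; ring

lemma FT2_g_bound (η : ℝ → ℂ) (h1 : Continuous η) (h2 : HasCompactSupport η) (T : ℝ) (hT : 0 < T)
    (f S : SchwartzMap (ℝ × ℝ) ℂ)
    (hS : ∀ ξ τ, FT2 (fun x t => f (x, t)) ξ τ = S (ξ, τ)) (ξ τ : ℝ) :
    2 * π * ‖FT2 (fun x t => η (t / T) * ∫ t' in (0 : ℝ)..t, WpF (⇑f) (t - t') t' x) ξ τ‖ ≤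
      ‖∫ σ, Mk η T (τ + ξ ^ 5) σ * S (ξ, σ - ξ ^ 5)‖ := by
  have hpi : ((2 * π : ℝ) : ℂ) ≠ 0 := by exact_mod_cast (by positivity : (2 * π : ℝ) ≠ 0)
  set c : ℂ := (Real.sqrt (2 * π) : ℂ)⁻¹ with hc
  let F : ℝ → ℝ → ℂ := fun ξ t => c * ∫ τ : ℝ, ex (t * τ) * S (ξ, τ)
  have hF : ∀ ξ t, FT1 (fun y => f (y, t)) ξ = F ξ t := FT1_inv f S hS
  have hFc : Continuous fun p : ℝ × ℝ => F p.1 p.2 := Fh_cont S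
  obtain ⟨C, hC, hFb⟩ := Fh_bound S
  have hcs : ∀ r : ℝ, HasCompactSupport fun t : ℝ => ex (-(t * r)) * η (t / T) := by
    intro r
    refine HasCompactSupport.mul_left ?_
    have := h2.comp_homeomorph (Homeomorph.mulRight₀ (T⁻¹) (by positivity))
    simpa [Function.comp_def, div_eq_mul_inv] using this
  have hac : ∀ r : ℝ, Continuous fun t : ℝ => ex (-(t * r)) * η (t / T) := by
    intro r; fun_prop
  let P : ℝ → ℝ → ℝ → ℝ → ℂ := fun x t t' u => ex (x * u - (t - t') * u ^ 5) * F u t'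
  have hP : ∀ x, Continuous fun p : ℝ × ℝ × ℝ => P x p.1 p.2.1 p.2.2 := by
    intro x
    have : Continuous fun p : ℝ × ℝ × ℝ => F p.2.2 p.2.1 :=
      hFc.comp (by fun_prop : Continuous fun p : ℝ × ℝ × ℝ => (p.2.2, p.2.1))
    refine Continuous.mul ?_ this
    fun_prop
  have hfub := fun x => fub (fun t => ex (-(t * τ)) * η (t / T)) (hac τ) (hcs τ) (P x) (hP x)
    (fun u => C * (1 + |u|) ^ (-2 : ℝ)) C (brak_int.const_mul C)
    (fun u => mul_le_of_le_one_right hC (brak_le_one _ _ (by norm_num)))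
    (fun t t' u => by
      simp only [P]
      rw [norm_mul, ex_norm, one_mul]
      exact hFb u t')
  let J : ℝ → ℂ := fun u => ∫ t, (ex (-(t * τ)) * η (t / T)) * ∫ t' in (0:ℝ)..t, P 0 t t' u
  have hJ : ∀ x u, (∫ t, (ex (-(t * τ)) * η (t / T)) * ∫ t' in (0:ℝ)..t, P x t t' u) =
      ex (u * x) * J u := by
    intro x u
    have e : ∀ t t', P x t t' u = ex (u * x) * P 0 t t' u := by
      intro t t'
      have e4 : ex (x * u - (t - t') * u ^ 5) = ex (u * x) * ex (0 * u - (t - t') * u ^ 5) := by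
        rw [← ex_add]; congr 1; ring
      simp only [P]
      rw [e4, mul_assoc]
    simp only [e, J]
    rw [← integral_const_mul]
    congr 1; ext t
    rw [intervalIntegral.integral_const_mul]; ring
  have hJi : Integrable J := (hfub 0).2.1
  have hJc : Continuous J := (hfub 0).2.2
  let K : ℝ → ℂ := fun x => ∫ u, ex (u * x) * J u
  have hK : ∀ x, (∫ t, (ex (-(t * τ)) * η (t / T)) * ∫ t' in (0:ℝ)..t, ∫ u, P x t t' u) = K x := by
    intro x
    rw [(hfub x).1]
    simp only [hJ, K]
  have hW : ∀ t t' x, WpF (⇑f) (t - t') t' x = c * ∫ u, P x t t' u := by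
    intro t t' x
    unfold WpF
    congr 2; ext u
    rw [hF]
    simp only [P, ex]
    congr 2; push_cast; ring
  have hg : FT2 (fun x t => η (t / T) * ∫ t' in (0 : ℝ)..t, WpF (⇑f) (t - t') t' x) ξ τ =
      ((2 * π : ℝ) : ℂ)⁻¹ * (c * ∫ x, ex (-(ξ * x)) * K x) := by
    rw [FT2_ex]
    congr 1
    rw [← integral_const_mul]
    congr 1; ext x
    rw [← hK, ← integral_const_mul, ← integral_const_mul]
    congr 1; ext t
    simp only [hW]
    rw [intervalIntegral.integral_const_mul, show -(x * ξ + t * τ) = -(ξ * x) + -(t * τ) by ring,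
      ex_add]
    ring
  have hbJ : ‖∫ x, ex (-(ξ * x)) * K x‖ ≤ 2 * π * ‖J ξ‖ := by
    by_cases hKi : Integrable K
    · rw [inv2 J hJc hJi hKi ξ, norm_mul, Complex.norm_real, Real.norm_eq_abs,
        abs_of_pos (by positivity)]
    · rw [integral_undef]
      · simp only [norm_zero]; positivity
      · intro hcon
        apply hKi
        have h3 := hcon.bdd_mul (c := 1) (f := fun x : ℝ => ex (ξ * x))
          (Continuous.aestronglyMeasurable (by fun_prop))
          (Filter.Eventually.of_forall fun x => (ex_norm _).le)
        refine h3.congr (Filter.Eventually.of_forall fun x => ?_)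
        simp only
        rw [← mul_assoc, ← ex_add, add_neg_cancel, ex_zero, one_mul]
  obtain ⟨C2, hC2, hSb, hSb2, -⟩ := sch_bound0 S
  have hJM : J ξ = c * ∫ σ, Mk η T (τ + ξ ^ 5) σ * S (ξ, σ - ξ ^ 5) := by
    have hSi : Integrable fun σ => S (ξ, σ - ξ ^ 5) := (sch_slice S ξ).comp_sub_right (ξ ^ 5)
    have hf2 := fub (fun t => ex (-(t * (τ + ξ ^ 5))) * η (t / T)) (hac _) (hcs _)
      (fun _ t' σ => ex (t' * σ) * S (ξ, σ - ξ ^ 5)) (by fun_prop)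
      (fun σ => ‖S (ξ, σ - ξ ^ 5)‖) C2 hSi.norm
      (fun σ => (hSb _ _).trans (mul_le_of_le_one_right hC2 (brak_le_one _ _ (by norm_num))))
      (fun t t' σ => by rw [norm_mul, ex_norm, one_mul])
    have e1 : (∫ σ, Mk η T (τ + ξ ^ 5) σ * S (ξ, σ - ξ ^ 5)) =
        ∫ σ, ∫ t, (ex (-(t * (τ + ξ ^ 5))) * η (t / T)) *
          ∫ t' in (0:ℝ)..t, ex (t' * σ) * S (ξ, σ - ξ ^ 5) := by
      congr 1; ext σ
      unfold Mk
      rw [← integral_mul_const]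
      congr 1; ext t
      rw [intervalIntegral.integral_mul_const]; ring
    rw [e1, ← hf2.1, ← integral_const_mul]
    simp only [J]
    congr 1; ext t
    have e2 : ∀ t', P 0 t t' ξ = (c * ex (-(t * ξ ^ 5))) * ∫ σ, ex (t' * σ) * S (ξ, σ - ξ ^ 5) := by
      intro t'
      simp only [P, F]
      rw [← integral_sub_right_eq_self (fun τ => ex (t' * τ) * S (ξ, τ)) (ξ ^ 5)]
      have e3 : ∀ σ : ℝ, ex (t' * (σ - ξ ^ 5)) * S (ξ, σ - ξ ^ 5) =
          ex (-(t' * ξ ^ 5)) * (ex (t' * σ) * S (ξ, σ - ξ ^ 5)) := by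
        intro σ
        rw [← mul_assoc, ← ex_add]; congr 2; ring
      simp only [e3]
      rw [integral_const_mul]
      have e4 : ex (-(t * ξ ^ 5)) = ex (0 * ξ - (t - t') * ξ ^ 5) * ex (-(t' * ξ ^ 5)) := by
        rw [← ex_add]; congr 1; ring
      rw [e4]; ring
    simp only [e2]
    rw [intervalIntegral.integral_const_mul]
    have e5 : ex (-(t * (τ + ξ ^ 5))) = ex (-(t * τ)) * ex (-(t * ξ ^ 5)) := by
      rw [← ex_add]; congr 1; ring
    rw [e5]; ring
  have hcn : ‖c‖ * ‖c‖ = (2 * π)⁻¹ := by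
    rw [hc, norm_inv, Complex.norm_real, Real.norm_eq_abs, abs_of_nonneg (Real.sqrt_nonneg _),
      ← mul_inv, Real.mul_self_sqrt (by positivity)]
  rw [hg, norm_mul, norm_mul, norm_inv, Complex.norm_real, Real.norm_eq_abs,
    abs_of_pos (by positivity : 0 < 2 * π)]
  rw [hJM, norm_mul] at hbJ
  calc 2 * π * ((2 * π)⁻¹ * (‖c‖ * ‖∫ x, ex (-(ξ * x)) * K x‖))
      ≤ 2 * π * ((2 * π)⁻¹ * (‖c‖ * (2 * π * (‖c‖ * ‖∫ σ, Mk η T (τ + ξ ^ 5) σ * S (ξ, σ - ξ ^ 5)‖)))) := by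
        gcongr
    _ = (‖c‖ * ‖c‖) * (2 * π) * ‖∫ σ, Mk η T (τ + ξ ^ 5) σ * S (ξ, σ - ξ ^ 5)‖ := by
        field_simp
    _ = _ := by rw [hcn, inv_mul_cancel₀ (by positivity), one_mul]

lemma RHS_int (s b' : ℝ) (hb' : b' ≤ 0) (S : SchwartzMap (ℝ × ℝ) ℂ) :
    Integrable (fun p : ℝ × ℝ =>
      (1 + |p.1|) ^ (2 * s) * (1 + |p.2 + p.1 ^ 5|) ^ (2 * b') * ‖S (p.1, p.2)‖ ^ 2)
      ((volume : Measure ℝ).prod volume) := by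
  obtain ⟨k, hk⟩ := exists_nat_ge (s + 1)
  obtain ⟨C, hC, hb⟩ := sch_bound S k
  refine Integrable.mono' ((brak_int.mul_prod brak_int).const_mul (C ^ 2))
      (Continuous.aestronglyMeasurable ?_) (Filter.Eventually.of_forall fun p => ?_)
  · refine Continuous.mul (Continuous.mul ?_ ?_) (S.continuous.norm.pow 2)
    · exact Continuous.rpow_const (by fun_prop) fun a => Or.inl (by positivity)
    · exact Continuous.rpow_const (by fun_prop) fun a => Or.inl (by positivity)
  · obtain ⟨ξ, τ⟩ := p
    simp only
    have px : 0 < 1 + |ξ| := by positivity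
    have pt : 0 < 1 + |τ| := by positivity
    rw [Real.norm_of_nonneg (by positivity)]
    have hw : (1 + |τ + ξ ^ 5|) ^ (2 * b') ≤ 1 :=
      Real.rpow_le_one_of_one_le_of_nonpos (by linarith [abs_nonneg (τ + ξ ^ 5)]) (by linarith)
    calc _ ≤ (1 + |ξ|) ^ (2 * s) * 1 * (C * ((1 + |ξ|) ^ (-(k : ℝ)) * (1 + |τ|) ^ (-2 : ℝ))) ^ 2 := by
          gcongr
          exact hb ξ τ
      _ = C ^ 2 * ((1 + |ξ|) ^ (2 * s + -(k : ℝ) + -(k : ℝ)) * ((1 + |τ|) ^ (-2 : ℝ) * (1 + |τ|) ^ (-2 : ℝ))) := by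
          rw [Real.rpow_add px, Real.rpow_add px]; ring
      _ ≤ C ^ 2 * ((1 + |ξ|) ^ (-2 : ℝ) * ((1 + |τ|) ^ (-2 : ℝ) * 1)) := by
          gcongr
          · linarith [abs_nonneg ξ]
          · linarith
          · exact brak_le_one _ _ (by norm_num)
      _ = _ := by ring

lemma RHS_int_slice (b' : ℝ) (hb' : b' ≤ 0) (S : SchwartzMap (ℝ × ℝ) ℂ) (ξ : ℝ) :
    Integrable (fun τ : ℝ => (1 + |τ + ξ ^ 5|) ^ (2 * b') * ‖S (ξ, τ)‖ ^ 2) := by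
  obtain ⟨C, hC, hb, -, -⟩ := sch_bound0 S
  refine Integrable.mono' (brak_int.const_mul (C ^ 2))
      (Continuous.aestronglyMeasurable ?_) (Filter.Eventually.of_forall fun τ => ?_)
  · refine Continuous.mul ?_ (by fun_prop)
    exact Continuous.rpow_const (by fun_prop) fun a => Or.inl (by positivity)
  · rw [Real.norm_of_nonneg (by positivity)]
    have hw : (1 + |τ + ξ ^ 5|) ^ (2 * b') ≤ 1 :=
      Real.rpow_le_one_of_one_le_of_nonpos (by linarith [abs_nonneg (τ + ξ ^ 5)]) (by linarith)
    calc _ ≤ 1 * (C * (1 + |τ|) ^ (-2 : ℝ)) ^ 2 := by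
          gcongr
          exact hb ξ τ
      _ = C ^ 2 * ((1 + |τ|) ^ (-2 : ℝ) * (1 + |τ|) ^ (-2 : ℝ)) := by ring
      _ ≤ C ^ 2 * ((1 + |τ|) ^ (-2 : ℝ) * 1) := by
          gcongr
          exact brak_le_one _ _ (by norm_num)
      _ = _ := by ring

theorem stmt2 (s b b' : ℝ) (hb'1 : -(1 / 2 : ℝ) < b') (hb'2 : b' ≤ 0) (hb0 : 0 ≤ b)
    (hb1 : b ≤ b' + 1)
    (η : ℝ → ℂ) (hηsmooth : ContDiff ℝ (⊤ : ℕ∞) η)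
    (hηsupp : Function.support η ⊆ Set.Icc (-1 : ℝ) 1)
    (hηone : ∀ t ∈ Set.Icc (-(1 / 2) : ℝ) (1 / 2), η t = 1) :
    ∃ C > (0 : ℝ), ∀ T ∈ Set.Ioc (0 : ℝ) 1, ∀ f : SchwartzMap (ℝ × ℝ) ℂ,
      Xnorm s b (fun x t => η (t / T) * ∫ t' in (0 : ℝ)..t, WpF (⇑f) (t - t') t' x) ≤
        C * T ^ (1 - b + b') * Xnorm s b' (fun x t => f (x, t)) := by
  have hc : HasCompactSupport η :=
    HasCompactSupport.of_support_subset_isCompact isCompact_Icc hηsupp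
  obtain ⟨C, hC, hone⟩ := oneD b b' hb'1 hb'2 hb0 hb1 η hηsmooth hηsupp
  refine ⟨Real.sqrt C, Real.sqrt_pos.mpr hC, ?_⟩
  rintro T ⟨hT, hT1⟩ f
  obtain ⟨S, hS⟩ := FT2_schwartz f
  unfold Xnorm
  simp only [hS]
  set g : ℝ → ℝ → ℂ := fun x t => η (t / T) * ∫ t' in (0 : ℝ)..t, WpF (⇑f) (t - t') t' x with hg
  have hgb := FT2_g_bound η hηsmooth.continuous hc T hT f S hS
  have hRi := RHS_int s b' hb'2 S
  have inner : ∀ ξ : ℝ,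
      ∫ τ : ℝ, (1 + |ξ|) ^ (2 * s) * (1 + |τ + ξ ^ 5|) ^ (2 * b) * ‖FT2 g ξ τ‖ ^ 2 ≤
      C * (T ^ (1 - b + b')) ^ 2 *
        ∫ τ : ℝ, (1 + |ξ|) ^ (2 * s) * (1 + |τ + ξ ^ 5|) ^ (2 * b') * ‖S (ξ, τ)‖ ^ 2 := by
    intro ξ
    simp only [mul_assoc ((1 + |ξ|) ^ (2 * s))]
    rw [integral_const_mul, integral_const_mul, mul_left_comm]
    refine mul_le_mul_of_nonneg_left ?_ (by positivity)
    have sh1 := integral_add_right_eq_self (μ := volume)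
      (fun τ : ℝ => (1 + |τ|) ^ (2 * b) * ‖FT2 g ξ (τ - ξ ^ 5)‖ ^ 2) (ξ ^ 5)
    have sh2 := integral_add_right_eq_self (μ := volume)
      (fun τ : ℝ => (1 + |τ|) ^ (2 * b') * ‖S (ξ, τ - ξ ^ 5)‖ ^ 2) (ξ ^ 5)
    simp only [add_sub_cancel_right] at sh1 sh2
    rw [sh1, sh2]
    refine hone T ⟨hT, hT1⟩ (fun σ => S (ξ, σ - ξ ^ 5)) (by fun_prop) ?_
      (fun τ => ‖FT2 g ξ (τ - ξ ^ 5)‖) (fun τ => norm_nonneg _) (fun τ => ?_)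
    · have := (RHS_int_slice b' hb'2 S ξ).comp_sub_right (ξ ^ 5)
      simpa only [sub_add_cancel] using this
    · have := hgb ξ (τ - ξ ^ 5)
      rw [sub_add_cancel] at this
      refine le_trans ?_ this
      refine le_mul_of_one_le_left (norm_nonneg _) ?_
      linarith [Real.pi_gt_three]
  have outer : (∫ ξ : ℝ, ∫ τ : ℝ, (1 + |ξ|) ^ (2 * s) * (1 + |τ + ξ ^ 5|) ^ (2 * b) * ‖FT2 g ξ τ‖ ^ 2) ≤
      C * (T ^ (1 - b + b')) ^ 2 *
      ∫ ξ : ℝ, ∫ τ : ℝ, (1 + |ξ|) ^ (2 * s) * (1 + |τ + ξ ^ 5|) ^ (2 * b') * ‖S (ξ, τ)‖ ^ 2 := by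
    rw [← integral_const_mul]
    refine integral_mono_of_nonneg (Filter.Eventually.of_forall fun ξ => ?_) ?_
      (Filter.Eventually.of_forall inner)
    · exact integral_nonneg fun τ => by positivity
    · exact hRi.integral_prod_left.const_mul _
  refine (Real.sqrt_le_sqrt outer).trans (le_of_eq ?_)
  rw [Real.sqrt_mul (by positivity), Real.sqrt_mul hC.le, Real.sqrt_sq (by positivity)]
end

section
/- Let β ≥ γ ≥ 0 with β + γ > 1. Then there exists C > 0 (depending only on β, γ) such that for all a₁, a₂ ∈ ℝ, ∫_ℝ dx / (⟨x-a₁⟩^β ⟨x-a₂⟩^γ) ≤ C φ_β(a₁-a₂) / ⟨a₁-a₂⟩^γ, where φ_β(a) = 1 if β > 1, φ_β(a) = log(1+⟨a⟩) if β = 1, and φ_β(a) = ⟨a⟩^{1-β} if β < 1. -/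
open MeasureTheory

/-- The dominating profile, supported on `[1, ∞)`. -/
noncomputable def domF (β γ A : ℝ) : ℝ → ℝ := fun t =>
  (Set.Icc 1 A).indicator (fun t => (2 ^ γ * A ^ (-γ)) * t ^ (-β)) t +
    (Set.Ioi A).indicator (fun t => t ^ (-(β + γ))) t

lemma domF_nonneg (β γ A : ℝ) (hA : 1 ≤ A) (t : ℝ) : 0 ≤ domF β γ A t := by
  unfold domF
  apply add_nonneg
  · apply Set.indicator_nonneg
    intro x hx
    have : 0 < x := by linarith [hx.1]
    positivity
  · apply Set.indicator_nonneg
    intro x hx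
    have : 0 < x := by linarith [Set.mem_Ioi.1 hx]
    positivity

lemma domF_int1 (β A : ℝ) : IntegrableOn (fun t : ℝ => t ^ (-β)) (Set.Icc 1 A) := by
  apply ContinuousOn.integrableOn_Icc
  intro x hx
  apply ContinuousAt.continuousWithinAt
  exact Real.continuousAt_rpow_const _ _ (Or.inl (by linarith [hx.1]))

lemma domF_integrable (β γ A : ℝ) (hA : 1 ≤ A) (hsum : 1 < β + γ) :
    Integrable (domF β γ A) := by
  unfold domF
  apply Integrable.add
  · rw [integrable_indicator_iff measurableSet_Icc]
    exact (domF_int1 β A).const_mul _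
  · rw [integrable_indicator_iff measurableSet_Ioi]
    exact integrableOn_Ioi_rpow_of_lt (by linarith) (by linarith)

lemma domF_integral (β γ A : ℝ) (hA : 1 ≤ A) (hsum : 1 < β + γ) :
    ∫ t, domF β γ A t =
      (2 ^ γ * (∫ t in (1:ℝ)..A, t ^ (-β)) + A ^ (1 - β) / (β + γ - 1)) / A ^ γ := by
  have hA0 : 0 < A := by linarith
  unfold domF
  rw [integral_add]
  · rw [integral_indicator measurableSet_Icc, integral_indicator measurableSet_Ioi,
      integral_const_mul, integral_Ioi_rpow_of_lt (by linarith) hA0,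
      integral_Icc_eq_integral_Ioc, ← intervalIntegral.integral_of_le hA]
    have e1 : A ^ (-(β + γ) + 1) = A ^ (1 - β) / A ^ γ := by
      rw [← Real.rpow_sub hA0]; congr 1; ring
    rw [e1, Real.rpow_neg hA0.le]
    have h1 : -(β + γ) + 1 ≠ 0 := by linarith
    have h2 : β + γ - 1 ≠ 0 := by linarith
    have e2 : -(β + γ) + 1 = -(β + γ - 1) := by ring
    rw [e2, div_neg, neg_div, neg_neg]
    field_simp
  · rw [integrable_indicator_iff measurableSet_Icc]
    exact (domF_int1 β A).const_mul _
  · rw [integrable_indicator_iff measurableSet_Ioi]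
    exact integrableOn_Ioi_rpow_of_lt (by linarith) (by linarith)

/-- Pointwise bound with the smaller variable. -/
lemma domF_bound (β γ A u v : ℝ) (hγ : 0 ≤ γ) (hβγ : γ ≤ β) (hA : 1 ≤ A) (hu : 1 ≤ u)
    (huv : u ≤ v) (h : A ≤ u + v) :
    (u ^ β * v ^ γ)⁻¹ ≤ domF β γ A u ∧ (v ^ β * u ^ γ)⁻¹ ≤ domF β γ A u := by
  have hu0 : 0 < u := by linarith
  have hv0 : 0 < v := by linarith
  have hA0 : 0 < A := by linarith
  have key : (u ^ β * v ^ γ)⁻¹ ≤ domF β γ A u := by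
    unfold domF
    by_cases hc : u ≤ A
    · rw [Set.indicator_of_mem (show u ∈ Set.Icc 1 A from ⟨hu, hc⟩),
        Set.indicator_of_notMem (by simpa using hc), add_zero, Real.rpow_neg hA0.le,
        Real.rpow_neg hu0.le]
      have h1 : (A / 2) ^ γ ≤ v ^ γ := Real.rpow_le_rpow (by linarith) (by linarith) hγ
      rw [Real.div_rpow hA0.le (by norm_num)] at h1
      have h2 : (2:ℝ) ^ γ * (A ^ γ)⁻¹ = (A ^ γ / 2 ^ γ)⁻¹ := by
        rw [inv_div, div_eq_mul_inv]
      rw [h2, mul_inv, mul_comm]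
      gcongr
    · push Not at hc
      rw [Set.indicator_of_notMem (by simp [hc]), Set.indicator_of_mem (Set.mem_Ioi.2 hc),
        zero_add, Real.rpow_neg hu0.le, Real.rpow_add hu0]
      gcongr
  refine ⟨key, le_trans ?_ key⟩
  have e1 : v ^ β = v ^ (β - γ) * v ^ γ := by rw [← Real.rpow_add hv0]; congr 1; ring
  have e2 : u ^ β = u ^ (β - γ) * u ^ γ := by rw [← Real.rpow_add hu0]; congr 1; ring
  have h1 : u ^ (β - γ) ≤ v ^ (β - γ) := Real.rpow_le_rpow hu0.le huv (by linarith)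
  apply inv_anti₀ (by positivity)
  rw [e1, e2, mul_assoc, mul_assoc, mul_comm (u ^ γ)]
  gcongr

/-- Control of the elementary one-dimensional integrals by the weight. -/
lemma phi_bound (β : ℝ) : ∃ K > (0:ℝ), ∀ A : ℝ, 1 ≤ A →
    (∫ t in (1:ℝ)..A, t ^ (-β)) ≤ K * (if 1 < β then 1
             else if β = 1 then Real.log (1 + A) else A ^ (1 - β)) ∧
    A ^ (1 - β) ≤ K * (if 1 < β then 1
             else if β = 1 then Real.log (1 + A) else A ^ (1 - β)) := by
  have hne : ∀ A : ℝ, 1 ≤ A → (0:ℝ) ∉ Set.uIcc 1 A := by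
    intro A hA h
    rw [Set.uIcc_of_le hA] at h
    linarith [h.1]
  rcases lt_trichotomy β 1 with hb | hb | hb
  · refine ⟨1 / (1 - β) + 1, by have : 0 < 1 - β := by linarith
                                positivity, fun A hA => ?_⟩
    have hA0 : 0 < A := by linarith
    have h0 : 0 < 1 - β := by linarith
    rw [if_neg (by linarith), if_neg (by linarith),
      integral_rpow (Or.inl (by linarith)), Real.one_rpow, show -β + 1 = 1 - β by ring]
    have hp : 0 < A ^ (1 - β) := by positivity
    have hi : 0 < 1 / (1 - β) := by positivity
    constructor
    · rw [sub_div, div_eq_mul_one_div]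
      nlinarith
    · nlinarith [mul_pos hi hp]
  · subst hb
    have hl2 : 0 < Real.log 2 := Real.log_pos (by norm_num)
    refine ⟨1 + 1 / Real.log 2, by positivity, fun A hA => ?_⟩
    have hA0 : 0 < A := by linarith
    rw [if_neg (by linarith), if_pos rfl]
    have e : (∫ t in (1:ℝ)..A, t ^ (-1:ℝ)) = Real.log A := by
      simp_rw [Real.rpow_neg_one]
      rw [integral_inv_of_pos one_pos hA0, div_one]
    rw [e, sub_self, Real.rpow_zero]
    have h1 : Real.log A ≤ Real.log (1 + A) := Real.log_le_log hA0 (by linarith)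
    have h2 : Real.log 2 ≤ Real.log (1 + A) := Real.log_le_log (by norm_num) (by linarith)
    have h3 : 1 ≤ 1 / Real.log 2 * Real.log (1 + A) := by
      rw [one_div_mul_eq_div, le_div_iff₀ hl2]; linarith
    constructor <;> nlinarith
  · have h0 : 0 < β - 1 := by linarith
    refine ⟨1 / (β - 1) + 1, by positivity, fun A hA => ?_⟩
    have hA0 : 0 < A := by linarith
    rw [if_pos hb, integral_rpow (Or.inr ⟨by linarith, hne A hA⟩), Real.one_rpow]
    have hp : 0 < A ^ (-β + 1) := by positivity
    have hi : 0 < 1 / (β - 1) := by positivity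
    constructor
    · rw [show -β + 1 = -(β - 1) by ring] at *
      rw [div_neg, ← neg_div, neg_sub, sub_div]
      have : 0 < A ^ (-(β - 1)) / (β - 1) := by positivity
      linarith
    · have := Real.rpow_le_one_of_one_le_of_nonpos hA (show 1 - β ≤ 0 by linarith)
      linarith

theorem stmt6 (β γ : ℝ) (hγ : 0 ≤ γ) (hβγ : γ ≤ β) (hsum : 1 < β + γ) :
    ∃ C > (0 : ℝ), ∀ a₁ a₂ : ℝ,
      (∫ x : ℝ, ((1 + |x - a₁|) ^ β * (1 + |x - a₂|) ^ γ)⁻¹) ≤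
        C * (if 1 < β then 1
             else if β = 1 then Real.log (1 + (1 + |a₁ - a₂|))
             else (1 + |a₁ - a₂|) ^ (1 - β)) / (1 + |a₁ - a₂|) ^ γ := by
  obtain ⟨K, hK, hKb⟩ := phi_bound β
  have hs : 0 < β + γ - 1 := by linarith
  refine ⟨4 * (2 ^ γ * K + K / (β + γ - 1)), by positivity, fun a₁ a₂ => ?_⟩
  have hA : 1 ≤ 1 + |a₁ - a₂| := by linarith [abs_nonneg (a₁ - a₂)]
  have htri : ∀ x, |a₁ - a₂| ≤ |x - a₁| + |x - a₂| := fun x => by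
    rw [abs_sub_comm x a₁]; exact abs_sub_le _ _ _
  obtain ⟨A, hAe⟩ : ∃ A, A = 1 + |a₁ - a₂| := ⟨_, rfl⟩
  rw [← hAe] at hA ⊢
  have hA0 : 0 < A := by linarith
  have hF := domF_integrable β γ A hA hsum
  have hn := domF_nonneg β γ A hA
  have i1 (a : ℝ) : Integrable (fun x => domF β γ A (x - (a - 1))) := hF.comp_sub_right _
  have i2 (a : ℝ) : Integrable (fun x => domF β γ A ((1 + a) - x)) := hF.comp_sub_left _
  have habs (a x : ℝ) : domF β γ A (1 + |x - a|) ≤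
      domF β γ A (x - (a - 1)) + domF β γ A ((1 + a) - x) := by
    rcases abs_cases (x - a) with ⟨h, _⟩ | ⟨h, _⟩
    · rw [h, show 1 + (x - a) = x - (a - 1) by ring]
      linarith [hn ((1 + a) - x)]
    · rw [h, show 1 + -(x - a) = (1 + a) - x by ring]
      linarith [hn (x - (a - 1))]
  have hpt (x : ℝ) : ((1 + |x - a₁|) ^ β * (1 + |x - a₂|) ^ γ)⁻¹ ≤
      (domF β γ A (x - (a₁ - 1)) + domF β γ A ((1 + a₁) - x)) +
      (domF β γ A (x - (a₂ - 1)) + domF β γ A ((1 + a₂) - x)) := by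
    have p1 := abs_nonneg (x - a₁)
    have p2 := abs_nonneg (x - a₂)
    have t := htri x
    rcases le_total |x - a₁| |x - a₂| with h | h
    · have := (domF_bound β γ A (1 + |x - a₁|) (1 + |x - a₂|) hγ hβγ hA
        (by linarith) (by linarith) (by linarith)).1
      linarith [habs a₁ x, hn (x - (a₂ - 1)), hn ((1 + a₂) - x)]
    · have := (domF_bound β γ A (1 + |x - a₂|) (1 + |x - a₁|) hγ hβγ hA
        (by linarith) (by linarith) (by linarith)).2
      linarith [habs a₂ x, hn (x - (a₁ - 1)), hn ((1 + a₁) - x)]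
  have hmain := integral_mono_of_nonneg (μ := volume)
    (f := fun x : ℝ => ((1 + |x - a₁|) ^ β * (1 + |x - a₂|) ^ γ)⁻¹)
    (Filter.Eventually.of_forall fun x => by
      show (0:ℝ) ≤ _
      positivity)
    (((i1 a₁).add (i2 a₁)).add ((i1 a₂).add (i2 a₂)))
    (Filter.Eventually.of_forall hpt)
  refine hmain.trans ?_
  rw [integral_add' ((i1 a₁).add (i2 a₁)) ((i1 a₂).add (i2 a₂)),
    integral_add' (i1 a₁) (i2 a₁), integral_add' (i1 a₂) (i2 a₂)]
  simp only [integral_sub_right_eq_self (domF β γ A), integral_sub_left_eq_self (domF β γ A)]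
  rw [domF_integral β γ A hA hsum]
  obtain ⟨b1, b2⟩ := hKb A hA
  generalize (if 1 < β then 1 else if β = 1 then Real.log (1 + A) else A ^ (1 - β)) = φ at *
  have b3 : (2 ^ γ * (∫ t in (1:ℝ)..A, t ^ (-β)) + A ^ (1 - β) / (β + γ - 1)) / A ^ γ ≤
      (2 ^ γ * (K * φ) + (K * φ) / (β + γ - 1)) / A ^ γ := by
    gcongr
  have b4 : 4 * (2 ^ γ * K + K / (β + γ - 1)) * φ / A ^ γ =
      4 * ((2 ^ γ * (K * φ) + (K * φ) / (β + γ - 1)) / A ^ γ) := by ring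
  rw [b4]
  linarith
end

section
/- Let ρ ∈ (1/2, 1). Then there exists C > 0 (depending only on ρ) such that for every a ∈ ℝ, ∫_ℝ dx / (⟨x⟩^ρ √|x-a|) ≤ C / ⟨a⟩^{ρ - 1/2}. -/
open MeasureTheory

lemma aux_low (s B : ℝ) (hs : -1 < s) (hB : 0 < B) :
    (∫ x : ℝ, (Set.Iic B).indicator (fun t : ℝ => t ^ s) |x|) = 2 * (B ^ (s + 1) / (s + 1)) := by
  rw [integral_comp_abs (f := (Set.Iic B).indicator (fun t : ℝ => t ^ s)),
    setIntegral_indicator measurableSet_Iic, Set.Ioi_inter_Iic,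
    ← intervalIntegral.integral_of_le hB.le, integral_rpow (Or.inl hs),
    Real.zero_rpow (by linarith), sub_zero]

lemma aux_high (s B : ℝ) (hs : s < -1) (hB : 0 < B) :
    (∫ x : ℝ, (Set.Ioi B).indicator (fun t : ℝ => t ^ s) |x|) = 2 * (-B ^ (s + 1) / (s + 1)) := by
  rw [integral_comp_abs (f := (Set.Ioi B).indicator (fun t : ℝ => t ^ s)),
    setIntegral_indicator measurableSet_Ioi, Set.Ioi_inter_Ioi, sup_eq_right.2 hB.le,
    integral_Ioi_rpow_of_lt hs hB]

lemma aux_low_int (s B : ℝ) (hs : -1 < s) (hB : 0 < B) :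
    Integrable (fun x : ℝ => (Set.Iic B).indicator (fun t : ℝ => t ^ s) |x|) := by
  apply Integrable.of_integral_ne_zero
  rw [aux_low s B hs hB]
  have : 0 < s + 1 := by linarith
  positivity

lemma aux_high_int (s B : ℝ) (hs : s < -1) (hB : 0 < B) :
    Integrable (fun x : ℝ => (Set.Ioi B).indicator (fun t : ℝ => t ^ s) |x|) := by
  apply Integrable.of_integral_ne_zero
  rw [aux_high s B hs hB]
  have h1 : s + 1 ≠ 0 := by linarith
  have h2 : B ^ (s + 1) ≠ 0 := by positivity
  simp [h1, h2]

lemma aux_pt (ρ B a x : ℝ) (h1 : 1 / 2 < ρ) (hB : 2 * B = 1 + |a|) (hx : x ≠ 0) (hxa : x ≠ a) :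
    ((1 + |x|) ^ ρ * Real.sqrt |x - a|)⁻¹ ≤
      B ^ (-ρ) * (Set.Iic B).indicator (fun t : ℝ => t ^ (-(1 / 2) : ℝ)) |x - a| +
      B ^ (-(1 / 2) : ℝ) * (Set.Iic (4 * B)).indicator (fun t : ℝ => t ^ (-ρ)) |x| +
      (1 / 2 : ℝ) ^ (-(1 / 2) : ℝ) *
        (Set.Ioi (4 * B)).indicator (fun t : ℝ => t ^ (-ρ - 1 / 2)) |x| := by
  have ha := abs_nonneg a
  have hB0 : 0 < B := by linarith
  have hx0 : 0 < |x| := abs_pos.2 hx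
  have hxa0 : 0 < |x - a| := abs_pos.2 (sub_ne_zero.2 hxa)
  have htri : |a| ≤ |x| + |x - a| := by
    have := abs_sub_abs_le_abs_sub a x
    rw [abs_sub_comm a x] at this
    linarith
  have htri2 : |x| ≤ |a| + |x - a| := by
    have := abs_sub_abs_le_abs_sub x a
    linarith
  have hL : ((1 + |x|) ^ ρ * Real.sqrt |x - a|)⁻¹
      = (1 + |x|) ^ (-ρ) * |x - a| ^ (-(1 / 2) : ℝ) := by
    rw [mul_inv, Real.rpow_neg (by positivity), Real.rpow_neg (by positivity), Real.sqrt_eq_rpow]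
  rw [hL]
  have n1 : 0 ≤ B ^ (-ρ) * (Set.Iic B).indicator (fun t : ℝ => t ^ (-(1 / 2) : ℝ)) |x - a| := by
    refine mul_nonneg (by positivity) ?_
    by_cases h : |x - a| ∈ Set.Iic B
    · rw [Set.indicator_of_mem h]; positivity
    · rw [Set.indicator_of_notMem h]
  have n2 : 0 ≤ B ^ (-(1 / 2) : ℝ) * (Set.Iic (4 * B)).indicator (fun t : ℝ => t ^ (-ρ)) |x| := by
    refine mul_nonneg (by positivity) ?_
    by_cases h : |x| ∈ Set.Iic (4 * B)
    · rw [Set.indicator_of_mem h]; positivity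
    · rw [Set.indicator_of_notMem h]
  have n3 : 0 ≤ (1 / 2 : ℝ) ^ (-(1 / 2) : ℝ) *
        (Set.Ioi (4 * B)).indicator (fun t : ℝ => t ^ (-ρ - 1 / 2)) |x| := by
    refine mul_nonneg (by positivity) ?_
    by_cases h : |x| ∈ Set.Ioi (4 * B)
    · rw [Set.indicator_of_mem h]; positivity
    · rw [Set.indicator_of_notMem h]
  have e1 : (1 + |x|) ^ (-ρ) ≤ |x| ^ (-ρ) :=
    Real.rpow_le_rpow_of_nonpos hx0 (by linarith) (by linarith)
  by_cases c1 : |x - a| ≤ B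
  · have e : (1 + |x|) ^ (-ρ) ≤ B ^ (-ρ) :=
      Real.rpow_le_rpow_of_nonpos hB0 (by linarith) (by linarith)
    have : (1 + |x|) ^ (-ρ) * |x - a| ^ (-(1 / 2) : ℝ) ≤
        B ^ (-ρ) * (Set.Iic B).indicator (fun t : ℝ => t ^ (-(1 / 2) : ℝ)) |x - a| := by
      rw [Set.indicator_of_mem (show |x - a| ∈ Set.Iic B from c1)]
      gcongr
    linarith
  by_cases c2 : |x| ≤ 4 * B
  · have e : |x - a| ^ (-(1 / 2) : ℝ) ≤ B ^ (-(1 / 2) : ℝ) :=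
      Real.rpow_le_rpow_of_nonpos hB0 (by linarith) (by norm_num)
    have : (1 + |x|) ^ (-ρ) * |x - a| ^ (-(1 / 2) : ℝ) ≤
        B ^ (-(1 / 2) : ℝ) * (Set.Iic (4 * B)).indicator (fun t : ℝ => t ^ (-ρ)) |x| := by
      rw [Set.indicator_of_mem (show |x| ∈ Set.Iic (4 * B) from c2), mul_comm]
      gcongr
    linarith
  · have e : |x - a| ^ (-(1 / 2) : ℝ) ≤ (1 / 2 * |x|) ^ (-(1 / 2) : ℝ) :=
      Real.rpow_le_rpow_of_nonpos (by positivity) (by linarith) (by norm_num)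
    have : (1 + |x|) ^ (-ρ) * |x - a| ^ (-(1 / 2) : ℝ) ≤
        (1 / 2 : ℝ) ^ (-(1 / 2) : ℝ) *
        (Set.Ioi (4 * B)).indicator (fun t : ℝ => t ^ (-ρ - 1 / 2)) |x| := by
      rw [Set.indicator_of_mem (show |x| ∈ Set.Ioi (4 * B) from not_le.1 c2)]
      calc _ ≤ |x| ^ (-ρ) * (1 / 2 * |x|) ^ (-(1 / 2) : ℝ) := by gcongr
        _ = _ := by
          rw [Real.mul_rpow (by norm_num) hx0.le, sub_eq_add_neg, Real.rpow_add hx0]; ring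
    linarith

theorem stmt7 (ρ : ℝ) (h1 : 1 / 2 < ρ) (h2 : ρ < 1) :
    ∃ C > (0 : ℝ), ∀ a : ℝ,
      (∫ x : ℝ, ((1 + |x|) ^ ρ * Real.sqrt |x - a|)⁻¹) ≤
        C / (1 + |a|) ^ (ρ - 1 / 2) := by
  have p1 : 0 < 1 - ρ := by linarith
  have p2 : 0 < ρ - 1 / 2 := by linarith
  refine ⟨(4 + 2 * (4 ^ (1 - ρ) / (1 - ρ)) + (1 / 2 : ℝ) ^ (-(1 / 2) : ℝ) *
    (2 * (4 ^ (1 / 2 - ρ) / (ρ - 1 / 2)))) * 2 ^ (ρ - 1 / 2), by positivity, fun a => ?_⟩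
  obtain ⟨B, hB⟩ : ∃ B, 2 * B = 1 + |a| := ⟨(1 + |a|) / 2, by ring⟩
  have hB0 : 0 < B := by have := abs_nonneg a; linarith
  have i1 := ((aux_low_int (-(1 / 2)) B (by norm_num) hB0).comp_sub_right a).const_mul (B ^ (-ρ))
  have i2 := (aux_low_int (-ρ) (4 * B) (by linarith) (by positivity)).const_mul
    (B ^ (-(1 / 2) : ℝ))
  have i3 := (aux_high_int (-ρ - 1 / 2) (4 * B) (by linarith) (by positivity)).const_mul
    ((1 / 2 : ℝ) ^ (-(1 / 2) : ℝ))
  have hae : ∀ᵐ x : ℝ, x ≠ 0 ∧ x ≠ a :=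
    (Measure.ae_ne volume 0).and (Measure.ae_ne volume a)
  refine (integral_mono_of_nonneg (Filter.Eventually.of_forall fun x => by
    simp only [Pi.zero_apply]; positivity) ((i1.add i2).add i3)
    (hae.mono fun x hx => aux_pt ρ B a x h1 hB hx.1 hx.2)).trans ?_
  have E := integral_add (i1.add i2) i3
  have E' := integral_add i1 i2
  simp only [Pi.add_apply] at E ⊢
  rw [E, E', integral_const_mul, integral_const_mul, integral_const_mul,
    integral_sub_right_eq_self (fun x : ℝ =>
      (Set.Iic B).indicator (fun t : ℝ => t ^ (-(1 / 2) : ℝ)) |x|) a,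
    aux_low _ _ (by norm_num) hB0, aux_low _ _ (by linarith) (by positivity),
    aux_high _ _ (by linarith) (by positivity), ← hB,
    Real.mul_rpow (by norm_num) hB0.le, Real.mul_rpow (by norm_num) hB0.le,
    Real.mul_rpow (by norm_num) hB0.le]
  have q1 : B ^ (-ρ) * B ^ (-(1 / 2) + 1 : ℝ) = (B ^ (ρ - 1 / 2))⁻¹ := by
    rw [← Real.rpow_add hB0, ← Real.rpow_neg hB0.le]; congr 1; ring
  have q2 : B ^ (-(1 / 2) : ℝ) * B ^ (-ρ + 1 : ℝ) = (B ^ (ρ - 1 / 2))⁻¹ := by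
    rw [← Real.rpow_add hB0, ← Real.rpow_neg hB0.le]; congr 1; ring
  have q3 : B ^ (-ρ - 1 / 2 + 1 : ℝ) = (B ^ (ρ - 1 / 2))⁻¹ := by
    rw [← Real.rpow_neg hB0.le]; congr 1; ring
  have s1 : (4 : ℝ) ^ (-ρ + 1) = 4 ^ (1 - ρ) := by congr 1; ring
  have s2 : (4 : ℝ) ^ (-ρ - 1 / 2 + 1) = 4 ^ (1 / 2 - ρ) := by congr 1; ring
  have s3 : (-ρ - 1 / 2 + 1 : ℝ) = -(ρ - 1 / 2) := by ring
  have s4 : (-ρ + 1 : ℝ) = 1 - ρ := by ring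
  have two : (2 : ℝ) ^ (ρ - 1 / 2) ≠ 0 := by positivity
  apply le_of_eq
  rw [q3, s1, s2]
  calc _ = (B ^ (-ρ) * B ^ (-(1 / 2) + 1 : ℝ)) * 4
        + (B ^ (-(1 / 2) : ℝ) * B ^ (-ρ + 1 : ℝ)) * (2 * (4 ^ (1 - ρ) / (-ρ + 1)))
        + (1 / 2 : ℝ) ^ (-(1 / 2) : ℝ) *
          (2 * (-(4 ^ (1 / 2 - ρ) * (B ^ (ρ - 1 / 2))⁻¹) / (-ρ - 1 / 2 + 1))) := by
        congr 1
        congr 1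
        · rw [show (-(1 / 2) + 1 : ℝ) = 1 / 2 by norm_num]; ring
        · ring
    _ = _ := by
        rw [q1, q2, s3, neg_div_neg_eq, s4, ← div_div, mul_div_cancel_right₀ _ two]
        generalize B ^ (ρ - 1 / 2) = X, (4 : ℝ) ^ (1 - ρ) = Y, (4 : ℝ) ^ (1 / 2 - ρ) = Z,
          (1 / 2 : ℝ) ^ (-(1 / 2) : ℝ) = W, 1 - ρ = U, ρ - 1 / 2 = V
        simp only [div_eq_mul_inv]
        ring
end

section
/- Let 2/5 ≤ b < 1/2 and 0 ≤ a ≤ 10b - 4. Then there exists C > 0 (depending only on a, b) such that for all (ξ, τ) ∈ ℝ², ∬_{ℝ²} ⟨ξ⟩^{2a} ξ² / (⟨τ+ξ⁵⟩^{2b} ⟨τ₁+ξ₁⁵⟩^{2b} ⟨τ-τ₁+(ξ-ξ₁)⁵⟩^{2b}) dξ₁ dτ₁ ≤ C. -/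
open MeasureTheory

/-- basic kernel -/
noncomputable def kk (n : ℕ) (t : ℝ) : ℝ := max |t| (|t| ^ n)

lemma kk_neg (n : ℕ) (t : ℝ) : kk n (-t) = kk n t := by simp [kk]

lemma kk_nonneg (n : ℕ) (t : ℝ) : 0 ≤ kk n t := le_max_of_le_left (abs_nonneg t)

lemma kk_pos (n : ℕ) {t : ℝ} (ht : t ≠ 0) : 0 < kk n t := lt_max_of_lt_left (abs_pos.2 ht)

lemma kk_le_of_one_le (n : ℕ) (hn : 1 ≤ n) {t : ℝ} (ht : 1 ≤ |t|) : kk n t = |t| ^ n := by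
  unfold kk
  exact max_eq_right (by simpa using pow_le_pow_right₀ ht hn)

lemma kk_of_le_one (n : ℕ) (hn : 1 ≤ n) {t : ℝ} (ht : |t| ≤ 1) : kk n t = |t| := by
  unfold kk
  exact max_eq_left (by simpa using pow_le_pow_of_le_one (abs_nonneg t) ht hn)

lemma kk_integrable (n : ℕ) (hn : 1 ≤ n) (β : ℝ) (h1 : β < 1) (h2 : 1 < n * β) :
    Integrable (fun t : ℝ => (kk n t) ^ (-β)) := by
  have hI : IntegrableOn (fun t : ℝ => (kk n t) ^ (-β)) (Set.Ioi 0) := by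
    rw [← Set.Ioc_union_Ioi_eq_Ioi (zero_le_one : (0:ℝ) ≤ 1)]
    refine IntegrableOn.union ?_ ?_
    · have h := (intervalIntegral.intervalIntegrable_rpow' (a := 0) (b := 1) (r := -β)
        (by linarith))
      rw [intervalIntegrable_iff_integrableOn_Ioc_of_le zero_le_one] at h
      refine h.congr_fun (fun x hx => ?_) measurableSet_Ioc
      have : |x| = x := abs_of_pos hx.1
      simp only
      rw [kk_of_le_one n hn (by rw [this]; exact hx.2), this]
    · have h := integrableOn_Ioi_rpow_of_lt (a := -(n * β)) (c := 1) (by linarith) one_pos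
      refine h.congr_fun (fun x hx => ?_) measurableSet_Ioi
      have hx0 : (0:ℝ) < x := lt_trans one_pos hx
      have : |x| = x := abs_of_pos hx0
      simp only
      rw [kk_le_of_one_le n hn (by rw [this]; exact le_of_lt hx), this, ← Real.rpow_natCast,
        ← Real.rpow_mul hx0.le]
      congr 1; ring
  have hI2 : IntegrableOn (fun t : ℝ => (kk n t) ^ (-β)) (Set.Iio 0) := by
    have := hI.comp_neg
    simpa [kk_neg] using this
  have h3 := (integrableOn_Iic_iff_integrableOn_Iio (μ := volume)).2 hI2
  rw [← integrableOn_univ, ← Set.Iic_union_Ioi (a := (0:ℝ))]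
  exact h3.union hI

lemma scale_int {K : ℝ → ℝ} (hK : Integrable K) (x0 r : ℝ) (hr : 0 < r) :
    Integrable (fun x => K ((x - x0) / r)) ∧ ∫ x, K ((x - x0) / r) = r * ∫ x, K x := by
  constructor
  · exact (hK.comp_div hr.ne').comp_sub_right x0
  · rw [integral_sub_right_eq_self (fun x => K (x / r)) x0, Measure.integral_comp_div,
      abs_of_pos hr, smul_eq_mul]

lemma conv_half (γ : ℝ) (hγ : 0 < γ) (p q : ℝ) (hp : p ≠ 0) (hpq : |p| ≤ |q|) :
    ((1 + |p|) ^ γ * (1 + |q|) ^ γ)⁻¹ ≤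
      (((1 + |p - q|) / 2) ^ 2) ^ (-γ) * (kk 2 (p / ((1 + |p - q|) / 2))) ^ (-γ) := by
  set e := (1 + |p - q|) / 2 with he
  have he0 : 0 < e := by positivity
  have hq : e ≤ 1 + |q| := by
    have := abs_sub p q
    linarith
  have hp0 : 0 < |p| := abs_pos.2 hp
  rw [← Real.mul_rpow (by positivity) (by positivity), ← Real.rpow_neg (by positivity),
    ← Real.mul_rpow (by positivity) (kk_nonneg _ _)]
  refine Real.rpow_le_rpow_of_nonpos ?_ ?_ (by linarith)
  · have := kk_pos 2 (div_ne_zero hp he0.ne')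
    positivity
  · unfold kk
    rw [mul_max_of_nonneg _ _ (by positivity), abs_div, abs_of_pos he0]
    apply max_le
    · have : e ^ 2 * (|p| / e) = |p| * e := by field_simp
      rw [this]
      exact mul_le_mul (by linarith) hq he0.le (by positivity)
    · have : e ^ 2 * (|p| / e) ^ 2 = |p| * |p| := by field_simp
      rw [this]
      exact mul_le_mul (by linarith) (by linarith) hp0.le (by positivity)

lemma conv_bound (γ : ℝ) (h1 : 1 / 2 < γ) (h2 : γ < 1) :
    ∃ C : ℝ, 0 ≤ C ∧ ∀ A B : ℝ,
      ∫ s : ℝ, ((1 + |s + A|) ^ γ * (1 + |B - s|) ^ γ)⁻¹ ≤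
        C * (1 + |A + B|) ^ (-(2 * γ - 1)) := by
  have hK := kk_integrable 2 (by norm_num) γ h2 (by push_cast; linarith)
  set I := ∫ t, (kk 2 t) ^ (-γ) with hI
  have hI0 : 0 ≤ I := integral_nonneg (fun t => Real.rpow_nonneg (kk_nonneg _ _) _)
  refine ⟨2 * I * (1/2) ^ (-(2 * γ - 1)), by positivity, fun A B => ?_⟩
  set e := (1 + |A + B|) / 2 with he
  have he0 : 0 < e := by positivity
  obtain ⟨i1, v1⟩ := scale_int hK (-A) e he0
  obtain ⟨i2, v2⟩ := scale_int hK B e he0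
  have hae : ∀ᵐ s : ℝ, ((1 + |s + A|) ^ γ * (1 + |B - s|) ^ γ)⁻¹ ≤
      (e ^ 2) ^ (-γ) * (kk 2 ((s - -A) / e) ^ (-γ) + kk 2 ((s - B) / e) ^ (-γ)) := by
    filter_upwards [Measure.ae_ne volume (-A), Measure.ae_ne volume B] with s hs1 hs2
    have n1 : 0 ≤ (e ^ 2) ^ (-γ) * kk 2 ((s - -A) / e) ^ (-γ) :=
      mul_nonneg (by positivity) (Real.rpow_nonneg (kk_nonneg _ _) _)
    have n2 : 0 ≤ (e ^ 2) ^ (-γ) * kk 2 ((s - B) / e) ^ (-γ) :=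
      mul_nonneg (by positivity) (Real.rpow_nonneg (kk_nonneg _ _) _)
    rw [mul_add]
    have e1 : s + A = s - -A := by ring
    rw [abs_sub_comm B s, e1]
    rcases le_total |s - -A| |s - B| with h | h
    · have := conv_half γ (by linarith) (s - -A) (s - B) (sub_ne_zero.2 hs1) h
      have e2 : s - -A - (s - B) = A + B := by ring
      rw [e2, ← he] at this
      linarith
    · have := conv_half γ (by linarith) (s - B) (s - -A) (sub_ne_zero.2 hs2) h
      have e2 : s - B - (s - -A) = -(A + B) := by ring
      rw [e2, abs_neg, ← he, mul_comm ((1 + |s - B|) ^ γ)] at this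
      linarith
  calc _ ≤ ∫ s, (e ^ 2) ^ (-γ) * (kk 2 ((s - -A) / e) ^ (-γ) + kk 2 ((s - B) / e) ^ (-γ)) := by
        refine integral_mono_of_nonneg ?_ ((i1.add i2).const_mul _) hae
        exact Filter.Eventually.of_forall (fun s => by simp only [Pi.zero_apply]; positivity)
    _ = (e ^ 2) ^ (-γ) * (e * I + e * I) := by
        rw [integral_const_mul, integral_add i1 i2, v1, v2]
    _ = _ := by
        have h3 : (e ^ 2) ^ (-γ) * e = e ^ (-(2 * γ - 1)) := by
          rw [← Real.rpow_natCast, ← Real.rpow_mul he0.le]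
          nth_rewrite 2 [← Real.rpow_one e]
          rw [← Real.rpow_add he0]; congr 1; push_cast; ring
        have h4 : e ^ (-(2 * γ - 1)) = (1/2) ^ (-(2 * γ - 1)) * (1 + |A + B|) ^ (-(2 * γ - 1)) := by
          rw [← Real.mul_rpow (by norm_num) (by positivity)]; congr 1; rw [he]; ring
        calc _ = 2 * I * ((e ^ 2) ^ (-γ) * e) := by ring
          _ = _ := by rw [h3, h4]; ring

/-- phase -/
noncomputable def ff (μ ξ x : ℝ) : ℝ := μ + 5 / 2 * ξ ^ 3 * x ^ 2 + 5 * ξ * x ^ 4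

lemma phase_half (ξ r x0 x : ℝ) (hξ : 0 < ξ) (hr : 0 < r) (h0 : r / 4 ≤ x0) (hx : 0 ≤ x) :
    ξ * r ^ 4 * kk 4 ((x - x0) / r) ≤
      64 * |ff (-(5 / 2 * ξ ^ 3 * x0 ^ 2 + 5 * ξ * x0 ^ 4)) ξ x| := by
  have hx0 : 0 < x0 := by linarith
  have e1 : ff (-(5 / 2 * ξ ^ 3 * x0 ^ 2 + 5 * ξ * x0 ^ 4)) ξ x =
      (x - x0) * ((x + x0) * (5 / 2 * ξ ^ 3 + 5 * ξ * (x ^ 2 + x0 ^ 2))) := by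
    unfold ff; ring
  have hpos : 0 ≤ (x + x0) * (5 / 2 * ξ ^ 3 + 5 * ξ * (x ^ 2 + x0 ^ 2)) := by positivity
  rw [e1, abs_mul, abs_of_nonneg hpos]
  set t := |x - x0| with ht
  have ht0 : 0 ≤ t := abs_nonneg _
  have htx : t ≤ x + x0 := by rw [ht, abs_le]; constructor <;> linarith
  have ht2 : t ^ 2 ≤ x ^ 2 + x0 ^ 2 := by
    rw [ht, sq_abs]; nlinarith [mul_nonneg hx hx0.le]
  have hge : ξ * (t * ((x + x0) * (x ^ 2 + x0 ^ 2))) ≤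
      t * ((x + x0) * (5 / 2 * ξ ^ 3 + 5 * ξ * (x ^ 2 + x0 ^ 2))) := by
    have : 0 ≤ t * (x + x0) * (5 / 2 * ξ ^ 3 + 4 * ξ * (x ^ 2 + x0 ^ 2)) := by positivity
    nlinarith
  refine le_trans ?_ (mul_le_mul_of_nonneg_left hge (by norm_num))
  unfold kk
  rw [mul_max_of_nonneg _ _ (by positivity), abs_div, abs_of_pos hr, ← ht]
  apply max_le
  · have e2 : ξ * r ^ 4 * (t / r) = ξ * (t * r ^ 3) := by field_simp
    have : r ^ 3 ≤ 64 * ((x + x0) * (x ^ 2 + x0 ^ 2)) := by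
      calc r ^ 3 ≤ (4 * x0) ^ 3 := pow_le_pow_left₀ hr.le (by linarith) 3
        _ = 64 * (x0 * x0 ^ 2) := by ring
        _ ≤ _ := by gcongr <;> nlinarith
    rw [e2]
    calc ξ * (t * r ^ 3) ≤ ξ * (t * (64 * ((x + x0) * (x ^ 2 + x0 ^ 2)))) := by gcongr
      _ = _ := by ring
  · have e2 : ξ * r ^ 4 * (t / r) ^ 4 = ξ * (t * (t * t ^ 2)) := by field_simp
    rw [e2]
    have : ξ * (t * (t * t ^ 2)) ≤ ξ * (t * ((x + x0) * (x ^ 2 + x0 ^ 2))) := by gcongr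
    have : 0 ≤ ξ * (t * (t * t ^ 2)) := by positivity
    linarith

lemma phase_dichotomy (ξ r μ : ℝ) (hξ : 0 < ξ) (hr : ξ ≤ r) :
    (∃ x0, ∀ x, ξ * r ^ 4 * kk 4 ((x - x0) / r) ≤ 64 * |ff μ ξ x| ∨
      ξ * r ^ 4 * kk 4 ((x + x0) / r) ≤ 64 * |ff μ ξ x|) ∨ -(ξ * r ^ 4 / 5) ≤ μ := by
  have hr0 : 0 < r := by linarith
  by_cases hμ : -(ξ * r ^ 4 / 5) ≤ μ
  · exact Or.inr hμ
  left
  push Not at hμ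
  set Y := r + 1 + |μ| / ξ with hY
  have hY1 : 1 ≤ Y := by have : 0 ≤ |μ| / ξ := by positivity
                         linarith
  have hYr : r / 4 ≤ Y := by have : 0 ≤ |μ| / ξ := by positivity
                             linarith
  have hYμ : |μ| ≤ ξ * Y := by
    have : ξ * Y = ξ * (r + 1) + |μ| := by rw [hY]; field_simp
    rw [this]; nlinarith
  have hcont : ContinuousOn (fun y : ℝ => 5 / 2 * ξ ^ 3 * y ^ 2 + 5 * ξ * y ^ 4)
      (Set.Icc (r / 4) Y) := by fun_prop
  have hmem : -μ ∈ Set.Icc (5 / 2 * ξ ^ 3 * (r/4) ^ 2 + 5 * ξ * (r/4) ^ 4)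
      (5 / 2 * ξ ^ 3 * Y ^ 2 + 5 * ξ * Y ^ 4) := by
    constructor
    · have : ξ ^ 3 * r ^ 2 ≤ ξ * r ^ 4 := by
        have : ξ ^ 2 ≤ r ^ 2 := pow_le_pow_left₀ hξ.le hr 2
        calc ξ ^ 3 * r ^ 2 = ξ * r ^ 2 * ξ ^ 2 := by ring
          _ ≤ ξ * r ^ 2 * r ^ 2 := by gcongr
          _ = _ := by ring
      have : 0 < ξ * r ^ 4 := by positivity
      nlinarith
    · have h1 : Y ≤ Y ^ 4 := by simpa using pow_le_pow_right₀ hY1 (show 1 ≤ 4 by norm_num)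
      have h2 : ξ * Y ≤ ξ * Y ^ 4 := by gcongr
      have h3 : 0 ≤ 5 / 2 * ξ ^ 3 * Y ^ 2 := by positivity
      have := neg_abs_le μ
      have : 0 ≤ ξ * Y := by positivity
      linarith
  obtain ⟨x0, hx0, hx0'⟩ := intermediate_value_Icc hYr hcont hmem
  have hμ' : μ = -(5 / 2 * ξ ^ 3 * x0 ^ 2 + 5 * ξ * x0 ^ 4) := by
    simp only at hx0'; linarith
  refine ⟨x0, fun x => ?_⟩
  rcases le_total 0 x with hx | hx
  · left
    rw [hμ']
    exact phase_half ξ r x0 x hξ hr0 hx0.1 hx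
  · right
    have := phase_half ξ r x0 (-x) hξ hr0 hx0.1 (by linarith)
    rw [hμ']
    have e1 : (x + x0) / r = -((-x - x0) / r) := by ring
    have e2 : ∀ m, ff m ξ x = ff m ξ (-x) := by intro m; unfold ff; ring
    rw [e1, kk_neg, e2]
    exact this

lemma weight_std (a b ξ : ℝ) (hb2 : b < 1 / 2) (hb1 : 2 / 5 ≤ b) (ha1 : 0 ≤ a)
    (ha2 : a ≤ 10 * b - 4) (hξ : 0 < ξ) :
    (1 + ξ) ^ (2 * a) * ξ ^ 2 * (ξ * (max 1 ξ) ^ 4 / 64) ^ (-(4 * b - 1)) * max 1 ξ ≤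
      2 ^ (2 * a) * 64 := by
  have h64 : ((1:ℝ) / 64) ^ (-(4 * b - 1)) ≤ 64 := by
    rw [one_div, Real.inv_rpow (by norm_num), Real.rpow_neg (by norm_num), inv_inv]
    calc (64:ℝ) ^ (4 * b - 1) ≤ 64 ^ (1:ℝ) :=
          Real.rpow_le_rpow_of_exponent_le (by norm_num) (by linarith)
      _ = 64 := by simp
  rcases le_total ξ 1 with h | h
  · rw [max_eq_left h]
    have e1 : ξ * 1 ^ 4 / 64 = ξ * (1 / 64) := by ring
    rw [e1, Real.mul_rpow hξ.le (by norm_num), mul_one]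
    have h1 : (1 + ξ) ^ (2 * a) ≤ 2 ^ (2 * a) :=
      Real.rpow_le_rpow (by linarith) (by linarith) (by linarith)
    have h2 : ξ ^ 2 * ξ ^ (-(4 * b - 1)) ≤ 1 := by
      rw [← Real.rpow_natCast, ← Real.rpow_add hξ]
      exact Real.rpow_le_one hξ.le h (by push_cast; linarith)
    calc (1 + ξ) ^ (2 * a) * ξ ^ 2 * (ξ ^ (-(4 * b - 1)) * (1 / 64) ^ (-(4 * b - 1)))
        = (1 + ξ) ^ (2 * a) * ((ξ ^ 2 * ξ ^ (-(4 * b - 1))) * (1 / 64) ^ (-(4 * b - 1))) := by ring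
      _ ≤ 2 ^ (2 * a) * (1 * 64) := by gcongr
      _ = _ := by ring
  · rw [max_eq_right h]
    have e1 : ξ * ξ ^ 4 / 64 = ξ ^ 5 * (1 / 64) := by ring
    rw [e1, Real.mul_rpow (by positivity) (by norm_num)]
    have h1 : (1 + ξ) ^ (2 * a) ≤ 2 ^ (2 * a) * ξ ^ (2 * a) := by
      rw [← Real.mul_rpow (by norm_num) hξ.le]
      exact Real.rpow_le_rpow (by linarith) (by linarith) (by linarith)
    have h2 : ξ ^ (2 * a) * ξ ^ 3 * (ξ ^ 5) ^ (-(4 * b - 1)) ≤ 1 := by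
      rw [← Real.rpow_natCast ξ 3, ← Real.rpow_natCast ξ 5, ← Real.rpow_mul hξ.le,
        ← Real.rpow_add hξ, ← Real.rpow_add hξ]
      exact Real.rpow_le_one_of_one_le_of_nonpos h (by push_cast; linarith)
    calc (1 + ξ) ^ (2 * a) * ξ ^ 2 * ((ξ ^ 5) ^ (-(4 * b - 1)) * (1 / 64) ^ (-(4 * b - 1))) * ξ
        ≤ (2 ^ (2 * a) * ξ ^ (2 * a)) * ξ ^ 2 *
          ((ξ ^ 5) ^ (-(4 * b - 1)) * (1 / 64) ^ (-(4 * b - 1))) * ξ := by gcongr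
      _ = 2 ^ (2 * a) * ((ξ ^ (2 * a) * ξ ^ 3 * (ξ ^ 5) ^ (-(4 * b - 1))) *
          (1 / 64) ^ (-(4 * b - 1))) := by ring
      _ ≤ 2 ^ (2 * a) * (1 * 64) := by gcongr
      _ = _ := by ring

lemma weight_far (a b ξ z : ℝ) (hb2 : b < 1 / 2) (hb1 : 2 / 5 ≤ b) (ha1 : 0 ≤ a)
    (ha2 : a ≤ 10 * b - 4) (hξ : 1 ≤ ξ) (hz : ξ ^ 5 / 2 ≤ z) :
    (1 + ξ) ^ (2 * a) * ξ ^ 2 * z ^ (-(2 * b)) * ξ ≤ 2 ^ (2 * a) * 64 := by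
  have hξ0 : 0 < ξ := by linarith
  have hz0 : 0 < z := lt_of_lt_of_le (by positivity) hz
  have hz1 : z ^ (-(2 * b)) ≤ (ξ ^ 5) ^ (-(2 * b)) * 2 := by
    have h2 : ((1:ℝ) / 2) ^ (-(2 * b)) ≤ 2 := by
      rw [one_div, Real.inv_rpow (by norm_num), Real.rpow_neg (by norm_num), inv_inv]
      calc (2:ℝ) ^ (2 * b) ≤ 2 ^ (1:ℝ) :=
            Real.rpow_le_rpow_of_exponent_le (by norm_num) (by linarith)
        _ = 2 := by simp
    calc z ^ (-(2 * b)) ≤ (ξ ^ 5 * (1 / 2)) ^ (-(2 * b)) :=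
          Real.rpow_le_rpow_of_nonpos (by positivity) (by linarith) (by linarith)
      _ = (ξ ^ 5) ^ (-(2 * b)) * (1 / 2) ^ (-(2 * b)) :=
          Real.mul_rpow (by positivity) (by norm_num)
      _ ≤ _ := by gcongr
  have h1 : (1 + ξ) ^ (2 * a) ≤ 2 ^ (2 * a) * ξ ^ (2 * a) := by
    rw [← Real.mul_rpow (by norm_num) hξ0.le]
    exact Real.rpow_le_rpow (by linarith) (by linarith) (by linarith)
  have h2 : ξ ^ (2 * a) * ξ ^ 3 * (ξ ^ 5) ^ (-(2 * b)) ≤ 1 := by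
    rw [← Real.rpow_natCast ξ 3, ← Real.rpow_natCast ξ 5, ← Real.rpow_mul hξ0.le,
      ← Real.rpow_add hξ0, ← Real.rpow_add hξ0]
    exact Real.rpow_le_one_of_one_le_of_nonpos hξ (by push_cast; linarith)
  calc (1 + ξ) ^ (2 * a) * ξ ^ 2 * z ^ (-(2 * b)) * ξ
      ≤ (2 ^ (2 * a) * ξ ^ (2 * a)) * ξ ^ 2 * ((ξ ^ 5) ^ (-(2 * b)) * 2) * ξ := by gcongr
    _ = 2 ^ (2 * a) * ((ξ ^ (2 * a) * ξ ^ 3 * (ξ ^ 5) ^ (-(2 * b))) * 2) := by ring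
    _ ≤ 2 ^ (2 * a) * (1 * 64) := by gcongr; norm_num
    _ = _ := by ring

lemma kk_rpow_bound (β c p F : ℝ) (hβ : 0 ≤ β) (hc : 0 < c) (hp : p ≠ 0)
    (h : c * kk 4 p ≤ F) : F ^ (-β) ≤ c ^ (-β) * kk 4 p ^ (-β) := by
  have := kk_pos 4 hp
  rw [← Real.mul_rpow hc.le this.le]
  exact Real.rpow_le_rpow_of_nonpos (by positivity) h (by linarith)

lemma dominate (a b ξ τ : ℝ) (hb1 : 2 / 5 ≤ b) (hb2 : b < 1 / 2) (ha1 : 0 ≤ a)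
    (ha2 : a ≤ 10 * b - 4) (hξ : 0 < ξ) :
    ∃ x0 c : ℝ, 0 ≤ c ∧
      (1 + ξ) ^ (2 * a) * ξ ^ 2 * (1 + |τ + ξ ^ 5|) ^ (-(2 * b)) * c * max 1 ξ ≤
        2 ^ (2 * a) * 64 ∧
      ∀ x, x ≠ x0 → x ≠ -x0 → (1 + |ff (τ + ξ ^ 5 / 16) ξ x|) ^ (-(4 * b - 1)) ≤
        c * (kk 4 ((x - x0) / max 1 ξ) ^ (-(4 * b - 1)) +
          kk 4 ((x + x0) / max 1 ξ) ^ (-(4 * b - 1))) := by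
  have hr0 : 0 < max 1 ξ := lt_max_of_lt_right hξ
  have hc0 : 0 < ξ * (max 1 ξ) ^ 4 / 64 := by positivity
  have hw := weight_std a b ξ hb2 hb1 ha1 ha2 hξ
  have hbr : (1 + |τ + ξ ^ 5|) ^ (-(2 * b)) ≤ 1 :=
    Real.rpow_le_one_of_one_le_of_nonpos (by linarith [abs_nonneg (τ + ξ ^ 5)]) (by linarith)
  have hstd : (1 + ξ) ^ (2 * a) * ξ ^ 2 * (1 + |τ + ξ ^ 5|) ^ (-(2 * b)) *
      (ξ * (max 1 ξ) ^ 4 / 64) ^ (-(4 * b - 1)) * max 1 ξ ≤ 2 ^ (2 * a) * 64 := by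
    refine le_trans ?_ hw
    refine mul_le_mul_of_nonneg_right (mul_le_mul_of_nonneg_right ?_ (by positivity)) hr0.le
    exact mul_le_of_le_one_right (by positivity) hbr
  have kn : ∀ t, 0 ≤ kk 4 t ^ (-(4 * b - 1)) := fun t => Real.rpow_nonneg (kk_nonneg _ _) _
  rcases phase_dichotomy ξ (max 1 ξ) (τ + ξ ^ 5 / 16) hξ (le_max_right _ _) with ⟨x0, hx0⟩ | hμ
  · refine ⟨x0, (ξ * (max 1 ξ) ^ 4 / 64) ^ (-(4 * b - 1)), by positivity, hstd, ?_⟩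
    intro x h1 h2
    have cn : 0 ≤ (ξ * (max 1 ξ) ^ 4 / 64) ^ (-(4 * b - 1)) := by positivity
    rw [mul_add]
    rcases hx0 x with h | h
    · have := kk_rpow_bound (4 * b - 1) _ ((x - x0) / max 1 ξ)
        (1 + |ff (τ + ξ ^ 5 / 16) ξ x|) (by linarith) hc0
        (div_ne_zero (sub_ne_zero.2 h1) hr0.ne') (by linarith)
      have := mul_nonneg cn (kn ((x + x0) / max 1 ξ))
      linarith
    · have := kk_rpow_bound (4 * b - 1) _ ((x + x0) / max 1 ξ)
        (1 + |ff (τ + ξ ^ 5 / 16) ξ x|) (by linarith) hc0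
        (div_ne_zero (fun h => h2 (by linarith)) hr0.ne') (by linarith)
      have := mul_nonneg cn (kn ((x - x0) / max 1 ξ))
      linarith
  · -- no stationary level
    have hF : ∀ x, 5 * ξ * x ^ 4 - ξ * (max 1 ξ) ^ 4 / 5 ≤ |ff (τ + ξ ^ 5 / 16) ξ x| := by
      intro x
      refine le_trans ?_ (le_abs_self _)
      unfold ff
      have : 0 ≤ 5 / 2 * ξ ^ 3 * x ^ 2 := by positivity
      linarith
    rcases le_total ξ 1 with h | h
    · refine ⟨0, (ξ * (max 1 ξ) ^ 4 / 64) ^ (-(4 * b - 1)), by positivity, hstd, ?_⟩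
      intro x h1 h2
      have cn : 0 ≤ (ξ * (max 1 ξ) ^ 4 / 64) ^ (-(4 * b - 1)) := by positivity
      rw [mul_add]
      have key : (ξ * (max 1 ξ) ^ 4 / 64) * kk 4 ((x - 0) / max 1 ξ) ≤
          1 + |ff (τ + ξ ^ 5 / 16) ξ x| := by
        have hFx := hF x
        rw [max_eq_left h] at hFx ⊢
        have hab := abs_nonneg (ff (τ + ξ ^ 5 / 16) ξ x)
        have hk : kk 4 ((x - 0) / 1) ≤ 1 + x ^ 4 := by
          unfold kk
          simp only [sub_zero, div_one]
          have e4 : |x| ^ 4 = x ^ 4 := Even.pow_abs (by decide) x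
          have x4 : 0 ≤ x ^ 4 := by positivity
          refine max_le ?_ (by linarith)
          rcases le_total |x| 1 with h' | h'
          · linarith
          · have := pow_le_pow_right₀ h' (show 1 ≤ 4 by norm_num)
            rw [pow_one] at this; linarith
        have := mul_le_mul_of_nonneg_left hk hξ.le
        have : 0 ≤ ξ * x ^ 4 := by positivity
        nlinarith
      have := kk_rpow_bound (4 * b - 1) _ ((x - 0) / max 1 ξ)
        (1 + |ff (τ + ξ ^ 5 / 16) ξ x|) (by linarith) hc0
        (div_ne_zero (sub_ne_zero.2 h1) hr0.ne') key
      have := mul_nonneg cn (kn ((x + 0) / max 1 ξ))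
      linarith
    · refine ⟨0, 1, zero_le_one, ?_, ?_⟩
      · rw [max_eq_right h] at hμ ⊢
        rw [mul_one]
        refine weight_far a b ξ _ hb2 hb1 ha1 ha2 h ?_
        have := le_abs_self (τ + ξ ^ 5)
        have : 0 ≤ ξ ^ 5 := by positivity
        nlinarith
      · intro x h1 h2
        rw [mul_add]
        have key : 1 * kk 4 ((x - 0) / max 1 ξ) ≤ 1 + |ff (τ + ξ ^ 5 / 16) ξ x| := by
          have hFx := hF x
          rw [max_eq_right h] at hFx ⊢
          have hab := abs_nonneg (ff (τ + ξ ^ 5 / 16) ξ x)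
          rw [one_mul, sub_zero]
          rcases le_total |x / ξ| 1 with h' | h'
          · rw [kk_of_le_one 4 (by norm_num) h']; linarith
          · rw [kk_le_of_one_le 4 (by norm_num) h']
            have e4 : |x / ξ| ^ 4 = (x / ξ) ^ 4 := Even.pow_abs (by decide) _
            have one : 1 ≤ |x / ξ| ^ 4 := one_le_pow₀ h'
            set y := x / ξ with hy
            have hx : x = ξ * y := by rw [hy]; field_simp
            rw [e4] at one ⊢
            rw [hx] at hFx ⊢
            have h5 : 1 ≤ ξ ^ 5 := one_le_pow₀ h
            have e5 : 5 * ξ * (ξ * y) ^ 4 - ξ * ξ ^ 4 / 5 = ξ ^ 5 * (5 * y ^ 4 - 1 / 5) := by ring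
            rw [e5] at hFx
            have : 1 * (5 * y ^ 4 - 1 / 5) ≤ ξ ^ 5 * (5 * y ^ 4 - 1 / 5) :=
              mul_le_mul_of_nonneg_right h5 (by linarith)
            linarith
        have := kk_rpow_bound (4 * b - 1) 1 ((x - 0) / max 1 ξ)
          (1 + |ff (τ + ξ ^ 5 / 16) ξ x|) (by linarith) one_pos
          (div_ne_zero (sub_ne_zero.2 h1) hr0.ne') key
        rw [Real.one_rpow] at this
        have := kn ((x + 0) / max 1 ξ)
        linarith

lemma outer_pos (a b : ℝ) (hb1 : 2 / 5 ≤ b) (hb2 : b < 1 / 2) (ha1 : 0 ≤ a)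
    (ha2 : a ≤ 10 * b - 4) :
    ∃ C : ℝ, 0 ≤ C ∧ ∀ ξ τ : ℝ, 0 < ξ → ∃ g : ℝ → ℝ, Integrable g ∧ ∫ x, g x ≤ C ∧
      ∀ᵐ x : ℝ, (1 + |ξ|) ^ (2 * a) * ξ ^ 2 * (1 + |τ + ξ ^ 5|) ^ (-(2 * b)) *
        (1 + |τ + x ^ 5 + (ξ - x) ^ 5|) ^ (-(4 * b - 1)) ≤ g x := by
  have hK := kk_integrable 4 (by norm_num) (4 * b - 1) (by linarith) (by push_cast; linarith)
  set I := ∫ t, (kk 4 t) ^ (-(4 * b - 1)) with hI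
  have hI0 : 0 ≤ I := integral_nonneg (fun t => Real.rpow_nonneg (kk_nonneg _ _) _)
  refine ⟨2 ^ (2 * a) * 64 * (2 * I), by positivity, fun ξ τ hξ => ?_⟩
  obtain ⟨x0, c, hc, hcw, hdom⟩ := dominate a b ξ τ hb1 hb2 ha1 ha2 hξ
  have hr0 : 0 < max 1 ξ := lt_max_of_lt_right hξ
  obtain ⟨i1, v1⟩ := scale_int hK (ξ / 2 + x0) _ hr0
  obtain ⟨i2, v2⟩ := scale_int hK (ξ / 2 - x0) _ hr0
  set W := (1 + ξ) ^ (2 * a) * ξ ^ 2 * (1 + |τ + ξ ^ 5|) ^ (-(2 * b)) with hW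
  have hW0 : 0 ≤ W := by positivity
  refine ⟨fun x => W * c * (kk 4 ((x - (ξ / 2 + x0)) / max 1 ξ) ^ (-(4 * b - 1)) +
    kk 4 ((x - (ξ / 2 - x0)) / max 1 ξ) ^ (-(4 * b - 1))), (i1.add i2).const_mul _, ?_, ?_⟩
  · rw [integral_const_mul, integral_add i1 i2, v1, v2, ← hI]
    calc W * c * (max 1 ξ * I + max 1 ξ * I) = (W * c * max 1 ξ) * (2 * I) := by ring
      _ ≤ _ := by gcongr
  · filter_upwards [Measure.ae_ne volume (ξ / 2 + x0), Measure.ae_ne volume (ξ / 2 - x0)]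
      with x hx1 hx2
    have := hdom (x - ξ / 2) (fun h => hx1 (by linarith)) (fun h => hx2 (by linarith))
    have e1 : ff (τ + ξ ^ 5 / 16) ξ (x - ξ / 2) = τ + x ^ 5 + (ξ - x) ^ 5 := by
      unfold ff; ring
    have e2 : x - ξ / 2 - x0 = x - (ξ / 2 + x0) := by ring
    have e3 : x - ξ / 2 + x0 = x - (ξ / 2 - x0) := by ring
    rw [e1, e2, e3] at this
    rw [abs_of_pos hξ, ← hW, mul_assoc W c]
    exact mul_le_mul_of_nonneg_left this hW0

lemma outer_all (a b : ℝ) (hb1 : 2 / 5 ≤ b) (hb2 : b < 1 / 2) (ha1 : 0 ≤ a)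
    (ha2 : a ≤ 10 * b - 4) :
    ∃ C : ℝ, 0 ≤ C ∧ ∀ ξ τ : ℝ, ∃ g : ℝ → ℝ, Integrable g ∧ ∫ x, g x ≤ C ∧
      ∀ᵐ x : ℝ, (1 + |ξ|) ^ (2 * a) * ξ ^ 2 * (1 + |τ + ξ ^ 5|) ^ (-(2 * b)) *
        (1 + |τ + x ^ 5 + (ξ - x) ^ 5|) ^ (-(4 * b - 1)) ≤ g x := by
  obtain ⟨C, hC, h⟩ := outer_pos a b hb1 hb2 ha1 ha2
  refine ⟨C, hC, fun ξ τ => ?_⟩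
  rcases lt_trichotomy ξ 0 with hξ | hξ | hξ
  · obtain ⟨g, hg, hgC, hae⟩ := h (-ξ) (-τ) (by linarith)
    refine ⟨fun x => g (-x), hg.comp_neg, by rw [integral_neg_eq_self g volume]; exact hgC, ?_⟩
    have hq := (Measure.measurePreserving_neg (volume : Measure ℝ)).quasiMeasurePreserving.ae hae
    filter_upwards [hq] with x hx
    have e1 : -τ + (-ξ) ^ 5 = -(τ + ξ ^ 5) := by ring
    have e2 : -τ + (-x) ^ 5 + (-ξ - -x) ^ 5 = -(τ + x ^ 5 + (ξ - x) ^ 5) := by ring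
    rw [e1, e2, abs_neg, abs_neg, abs_neg, neg_sq] at hx
    exact hx
  · refine ⟨fun _ => 0, integrable_zero _ _ _, by simpa using hC, ?_⟩
    exact Filter.Eventually.of_forall (fun x => by simp [hξ])
  · exact h ξ τ hξ

theorem stmt8 (b a : ℝ) (hb1 : 2 / 5 ≤ b) (hb2 : b < 1 / 2) (ha1 : 0 ≤ a)
    (ha2 : a ≤ 10 * b - 4) :
    ∃ C > (0 : ℝ), ∀ ξ τ : ℝ,
      (∫ ξ₁ : ℝ, ∫ τ₁ : ℝ,
          (1 + |ξ|) ^ (2 * a) * ξ ^ 2 /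
            ((1 + |τ + ξ ^ 5|) ^ (2 * b) * (1 + |τ₁ + ξ₁ ^ 5|) ^ (2 * b) *
              (1 + |τ - τ₁ + (ξ - ξ₁) ^ 5|) ^ (2 * b))) ≤ C := by
  obtain ⟨C1, hC1, hconv⟩ := conv_bound (2 * b) (by linarith) (by linarith)
  obtain ⟨C2, hC2, hout⟩ := outer_all a b hb1 hb2 ha1 ha2
  refine ⟨C1 * C2 + 1, by positivity, fun ξ τ => ?_⟩
  obtain ⟨g, hg, hgC, hae⟩ := hout ξ τ
  have hstep : ∫ ξ₁ : ℝ, ∫ τ₁ : ℝ,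
          (1 + |ξ|) ^ (2 * a) * ξ ^ 2 /
            ((1 + |τ + ξ ^ 5|) ^ (2 * b) * (1 + |τ₁ + ξ₁ ^ 5|) ^ (2 * b) *
              (1 + |τ - τ₁ + (ξ - ξ₁) ^ 5|) ^ (2 * b)) ≤ ∫ x, C1 * g x := by
    refine integral_mono_of_nonneg ?_ (hg.const_mul C1) ?_
    · exact Filter.Eventually.of_forall (fun x => integral_nonneg (fun t => by
        simp only [Pi.zero_apply]; positivity))
    · filter_upwards [hae] with x hx
      have hc := hconv (x ^ 5) (τ + (ξ - x) ^ 5)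
      have e1 : ∀ t : ℝ, (1 + |ξ|) ^ (2 * a) * ξ ^ 2 /
            ((1 + |τ + ξ ^ 5|) ^ (2 * b) * (1 + |t + x ^ 5|) ^ (2 * b) *
              (1 + |τ - t + (ξ - x) ^ 5|) ^ (2 * b)) =
          ((1 + |ξ|) ^ (2 * a) * ξ ^ 2 * (1 + |τ + ξ ^ 5|) ^ (-(2 * b))) *
          ((1 + |t + x ^ 5|) ^ (2 * b) * (1 + |τ + (ξ - x) ^ 5 - t|) ^ (2 * b))⁻¹ := by
        intro t
        have : τ - t + (ξ - x) ^ 5 = τ + (ξ - x) ^ 5 - t := by ring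
        rw [this, Real.rpow_neg (by positivity), div_eq_mul_inv, mul_assoc ((1 + |τ + ξ ^ 5|) ^ (2 * b)),
          mul_inv]
        ring
      simp_rw [e1]
      rw [integral_const_mul]
      have e2 : x ^ 5 + (τ + (ξ - x) ^ 5) = τ + x ^ 5 + (ξ - x) ^ 5 := by ring
      have e3 : -(2 * (2 * b) - 1) = -(4 * b - 1) := by ring
      rw [e2, e3] at hc
      calc _ ≤ ((1 + |ξ|) ^ (2 * a) * ξ ^ 2 * (1 + |τ + ξ ^ 5|) ^ (-(2 * b))) *
            (C1 * (1 + |τ + x ^ 5 + (ξ - x) ^ 5|) ^ (-(4 * b - 1))) :=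
            mul_le_mul_of_nonneg_left hc (by positivity)
        _ = C1 * ((1 + |ξ|) ^ (2 * a) * ξ ^ 2 * (1 + |τ + ξ ^ 5|) ^ (-(2 * b)) *
            (1 + |τ + x ^ 5 + (ξ - x) ^ 5|) ^ (-(4 * b - 1))) := by ring
        _ ≤ C1 * g x := mul_le_mul_of_nonneg_left hx hC1
  refine hstep.trans ?_
  rw [integral_const_mul]
  have := mul_le_mul_of_nonneg_left hgC hC1
  linarith
end

section
/- Let 3/8 < b < 1/2. Then there exists C > 0 (depending only on b) such that for all (ξ, τ) ∈ ℝ², ∬_{ℝ²} ξ² / (⟨τ+ξ⁵⟩^{2b} ⟨τ₁+ξ₁⁵⟩^{2b} ⟨τ-τ₁+(ξ-ξ₁)⁵⟩^{2b}) dξ₁ dτ₁ ≤ C |ξ|^{1/2} / (⟨τ+ξ⁵⟩^{2b} ⟨τ + (1/16)ξ⁵⟩^{4b - 3/2}). -/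
open MeasureTheory

/-- Auxiliary profile with an integrable singularity and decay at infinity. -/
noncomputable def auxH (r p t : ℝ) : ℝ := |t| ^ (-p) * (max r |t|) ^ (-p)

lemma auxH_nonneg {r : ℝ} (hr : 0 < r) (p t : ℝ) : 0 ≤ auxH r p t := by
  have : 0 < max r |t| := lt_max_of_lt_left hr
  unfold auxH; positivity

lemma auxH_abs (r p t : ℝ) : auxH r p |t| = auxH r p t := by simp [auxH]

lemma auxH_one_integrable {p : ℝ} (h1 : 1 / 2 < p) (h2 : p < 1) :
    Integrable (auxH 1 p) := by
  have hA : IntegrableOn (auxH 1 p) (Set.Ioc 0 1) := by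
    have h := (intervalIntegral.intervalIntegrable_rpow' (a := 0) (b := 1)
      (r := -p) (by linarith))
    rw [intervalIntegrable_iff_integrableOn_Ioc_of_le zero_le_one] at h
    refine h.congr_fun (fun x hx => ?_) measurableSet_Ioc
    simp only [Set.mem_Ioc] at hx
    simp [auxH, abs_of_pos hx.1, max_eq_left hx.2]
  have hB : IntegrableOn (auxH 1 p) (Set.Ioi 1) := by
    have h := integrableOn_Ioi_rpow_of_lt (a := -p + -p) (c := 1) (by linarith) one_pos
    refine h.congr_fun (fun x hx => ?_) measurableSet_Ioi
    simp only [Set.mem_Ioi] at hx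
    have h0 : 0 < x := by linarith
    simp [auxH, abs_of_pos h0, max_eq_right hx.le, Real.rpow_add h0]
  have hC : IntegrableOn (auxH 1 p) (Set.Ioi 0) := by
    rw [← Set.Ioc_union_Ioi_eq_Ioi (zero_le_one' ℝ)]
    exact hA.union hB
  have hD : Integrable ((Set.Ioi (0 : ℝ)).indicator (auxH 1 p)) :=
    (integrable_indicator_iff measurableSet_Ioi).2 hC
  refine (hD.add hD.comp_neg).congr ?_
  have hne : ∀ᵐ x : ℝ, x ≠ 0 := by simp [ae_iff]
  filter_upwards [hne] with x hx
  rcases lt_or_gt_of_ne hx with h | h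
  · simp [Set.indicator, h, not_lt.2 h.le, auxH]
  · simp [Set.indicator, h, not_lt.2 h.le, auxH]

lemma auxH_scale {r : ℝ} (hr : 0 < r) (p : ℝ) :
    auxH r p = fun t => r ^ (-(2 * p)) * auxH 1 p (r⁻¹ * t) := by
  funext t
  have e1 : |t| = r * |r⁻¹ * t| := by
    rw [abs_mul, abs_of_pos (inv_pos.2 hr)]; field_simp
  have e2 : max r |t| = r * max 1 |r⁻¹ * t| := by
    rw [mul_max_of_nonneg _ _ hr.le, ← e1, mul_one]
  have h3 : (0 : ℝ) ≤ max 1 |r⁻¹ * t| := le_max_of_le_left zero_le_one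
  unfold auxH
  rw [e2, e1, Real.mul_rpow hr.le (abs_nonneg _), Real.mul_rpow hr.le h3,
    show -(2 * p) = -p + -p by ring, Real.rpow_add hr]
  ring

lemma auxH_integrable {r p : ℝ} (hr : 0 < r) (h1 : 1 / 2 < p) (h2 : p < 1) :
    Integrable (auxH r p) := by
  rw [auxH_scale hr]
  exact ((auxH_one_integrable h1 h2).comp_mul_left' (inv_ne_zero hr.ne')).const_mul _

lemma auxH_integral {r : ℝ} (hr : 0 < r) (p : ℝ) :
    ∫ t, auxH r p t = r ^ (1 - 2 * p) * ∫ t, auxH 1 p t := by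
  rw [auxH_scale hr, integral_const_mul, Measure.integral_comp_mul_left, inv_inv, abs_of_pos hr,
    smul_eq_mul, ← mul_assoc, show 1 - 2 * p = -(2 * p) + 1 by ring, Real.rpow_add hr,
    Real.rpow_one]

lemma auxH_key_aux {x y r p : ℝ} (hx : 0 < x) (hr : 0 < r) (hp : 0 < p)
    (h : 2 * r ≤ x + y) (hxy : x ≤ y) : x ^ (-p) * y ^ (-p) ≤ auxH r p x := by
  unfold auxH
  rw [abs_of_pos hx]
  have h0 : 0 < max r x := lt_max_of_lt_left hr
  have : max r x ≤ y := max_le (by linarith) hxy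
  exact mul_le_mul_of_nonneg_left
    (Real.rpow_le_rpow_of_nonpos h0 this (by linarith)) (by positivity)

lemma auxH_key {x y r p : ℝ} (hx : 0 < x) (hy : 0 < y) (hr : 0 < r) (hp : 0 < p)
    (h : 2 * r ≤ x + y) : x ^ (-p) * y ^ (-p) ≤ auxH r p x + auxH r p y := by
  rcases le_total x y with hxy | hxy
  · linarith [auxH_key_aux hx hr hp h hxy, auxH_nonneg hr p y]
  · rw [mul_comm]
    linarith [auxH_key_aux hy hr hp (by linarith) hxy, auxH_nonneg hr p x]

lemma auxH_anti {t r p : ℝ} (ht : t ≠ 0) (hr : 0 < r) (hp : 0 < p) :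
    auxH r p (1 + |t|) ≤ auxH r p t := by
  unfold auxH
  have ht' : 0 < |t| := abs_pos.2 ht
  have h0 : 0 < max r |t| := lt_max_of_lt_left hr
  have h1 : |t| ≤ |(1 + |t|)| := le_trans (by linarith) (le_abs_self _)
  have h2 : max r |t| ≤ max r |(1 + |t|)| := max_le_max le_rfl h1
  have h3 : 0 < max r |(1 + |t|)| := lt_max_of_lt_left hr
  exact mul_le_mul (Real.rpow_le_rpow_of_nonpos ht' h1 (by linarith))
    (Real.rpow_le_rpow_of_nonpos h0 h2 (by linarith)) (by positivity) (by positivity)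

lemma shift_pair {r p : ℝ} (hr : 0 < r) (h1 : 1 / 2 < p) (h2 : p < 1) (u v : ℝ) :
    Integrable (fun t => auxH r p (t - u) + auxH r p (t - v)) ∧
    ∫ t, (auxH r p (t - u) + auxH r p (t - v)) =
      2 * (r ^ (1 - 2 * p) * ∫ t, auxH 1 p t) := by
  have hI := auxH_integrable hr h1 h2
  refine ⟨(hI.comp_sub_right u).add (hI.comp_sub_right v), ?_⟩
  rw [integral_add (hI.comp_sub_right u) (hI.comp_sub_right v),
    integral_sub_right_eq_self (auxH r p), integral_sub_right_eq_self (auxH r p),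
    auxH_integral hr]
  ring

lemma ae_ne_real (c : ℝ) : ∀ᵐ x : ℝ, x ≠ c := by simp [ae_iff]

/-- Convolution bound. -/
lemma conv_bound_s9 {p : ℝ} (h1 : 1 / 2 < p) (h2 : p < 1) (u v : ℝ) :
    ∫ t, (1 + |t - u|) ^ (-p) * (1 + |t - v|) ^ (-p) ≤
      2 * (((1 + |u - v|) / 2) ^ (1 - 2 * p) * ∫ t, auxH 1 p t) := by
  have hr : 0 < (1 + |u - v|) / 2 := by positivity
  obtain ⟨hI, hE⟩ := shift_pair hr h1 h2 u v
  rw [← hE]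
  refine integral_mono_of_nonneg (Filter.Eventually.of_forall fun t => by
    simp only [Pi.zero_apply]; positivity) hI ?_
  filter_upwards [ae_ne_real u, ae_ne_real v] with t hu hv
  refine (auxH_key (r := (1 + |u - v|) / 2) (by positivity) (by positivity) hr (by linarith)
    ?_).trans (add_le_add (auxH_anti (sub_ne_zero.2 hu) hr (by linarith))
      (auxH_anti (sub_ne_zero.2 hv) hr (by linarith)))
  have := abs_sub_le u t v
  rw [abs_sub_comm u t] at this
  linarith

/-- The quadratic integral. -/
lemma quad_bound {s : ℝ} (h1 : 1 / 2 < s) (h2 : s < 1) (A : ℝ) :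
    Integrable (fun w : ℝ => (1 + |(w ^ 2 - |A|)|) ^ (-s)) ∧
    ∫ w : ℝ, (1 + |(w ^ 2 - |A|)|) ^ (-s) ≤
      2 * ((1 + |A|) ^ (1 / 2 - s) * ∫ t, auxH 1 s t) := by
  set r := √(1 + |A|) with hrdef
  have hr : 0 < r := Real.sqrt_pos.2 (by positivity)
  have hr2 : r ^ 2 = 1 + |A| := Real.sq_sqrt (by positivity)
  obtain ⟨hI, hE⟩ := shift_pair hr h1 h2 r (-r)
  have hpow : r ^ (1 - 2 * s) = (1 + |A|) ^ (1 / 2 - s) := by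
    rw [← hr2, ← Real.rpow_natCast_mul hr.le]; congr 1; push_cast; ring
  rw [← hpow, ← hE]
  have hle : ∀ᵐ w : ℝ, (1 + |(w ^ 2 - |A|)|) ^ (-s) ≤
      auxH r s (w - r) + auxH r s (w - -r) := by
    filter_upwards [ae_ne_real r, ae_ne_real (-r)] with w hu hv
    have p1 : 0 < |w - r| := abs_pos.2 (sub_ne_zero.2 hu)
    have p2 : 0 < |w - -r| := abs_pos.2 (sub_ne_zero.2 hv)
    have h3 : |w - r| * |w - -r| ≤ 1 + |(w ^ 2 - |A|)| := by
      rw [← abs_mul, show (w - r) * (w - -r) = (w ^ 2 - |A|) - 1 by linarith [hr2]]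
      have := abs_sub (w ^ 2 - |A|) 1
      rw [abs_one] at this
      linarith
    have h4 := auxH_key (r := r) (p := s) p1 p2 hr (by linarith) (by
      have h5 := abs_sub (w - -r) (w - r)
      have h6 := le_abs_self ((w - -r) - (w - r))
      linarith)
    rw [auxH_abs, auxH_abs, ← Real.mul_rpow p1.le p2.le] at h4
    exact (Real.rpow_le_rpow_of_nonpos (by positivity) h3 (by linarith)).trans h4
  refine ⟨hI.mono' ?_ ?_, integral_mono_of_nonneg (Filter.Eventually.of_forall fun t => by
    simp only [Pi.zero_apply]; positivity) hI hle⟩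
  · exact (by fun_prop : Measurable fun w : ℝ => (1 + |(w ^ 2 - |A|)|) ^ (-s)).aestronglyMeasurable
  · filter_upwards [hle] with w hw
    rwa [Real.norm_of_nonneg (by positivity)]

/-- Change of variables. -/
lemma cov_bound {s : ℝ} (h1 : 1 / 2 < s) (h2 : s < 1) (A α β : ℝ) (hα : 0 < α) (hβ : 0 < β) :
    ∃ F : ℝ → ℝ, Integrable F ∧
      (∀ x, √α * (1 + |((α * x ^ 2 + β * x ^ 4) - |A|)|) ^ (-s) ≤ F x) ∧
      ∫ x, F x ≤ 2 * ((1 + |A|) ^ (1 / 2 - s) * ∫ t, auxH 1 s t) := by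
  obtain ⟨hI, hE⟩ := quad_bound h1 h2 A
  set g : ℝ → ℝ := fun w => (1 + |(w ^ 2 - |A|)|) ^ (-s) with hg
  set W : ℝ → ℝ := fun x => x * √(α + β * x ^ 2) with hW
  set W' : ℝ → ℝ := fun x => 1 * √(α + β * x ^ 2) +
    x * ((β * (2 * x)) / (2 * √(α + β * x ^ 2))) with hW'
  have hpos : ∀ x : ℝ, 0 < α + β * x ^ 2 := fun x => by positivity
  have hd : ∀ x, HasDerivAt W (W' x) x := by
    intro x
    have e1 : HasDerivAt (fun x : ℝ => α + β * x ^ 2) (β * (2 * x)) x := by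
      simpa using ((hasDerivAt_pow 2 x).const_mul β).const_add α
    exact (hasDerivAt_id x).mul (e1.sqrt (hpos x).ne')
  have hge : ∀ x, √α ≤ W' x := by
    intro x
    have a1 : √α ≤ √(α + β * x ^ 2) := Real.sqrt_le_sqrt (by nlinarith [sq_nonneg x])
    have a2 : 0 ≤ x * ((β * (2 * x)) / (2 * √(α + β * x ^ 2))) := by
      rw [show x * ((β * (2 * x)) / (2 * √(α + β * x ^ 2))) =
        (β * (2 * x ^ 2)) / (2 * √(α + β * x ^ 2)) by ring]
      positivity
    simp only [hW']
    linarith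
  have hα' : 0 < √α := Real.sqrt_pos.2 hα
  have hinj : Function.Injective W := by
    refine (strictMono_of_deriv_pos fun x => ?_).injective
    rw [(hd x).deriv]
    exact hα'.trans_le (hge x)
  have c1 := (integrableOn_image_iff_integrableOn_abs_deriv_smul MeasurableSet.univ
    (fun x _ => (hd x).hasDerivWithinAt) hinj.injOn g).1 hI.integrableOn
  have c2 := integral_image_eq_integral_abs_deriv_smul MeasurableSet.univ
    (fun x _ => (hd x).hasDerivWithinAt) hinj.injOn g
  rw [integrableOn_univ] at c1
  rw [setIntegral_univ] at c2
  refine ⟨_, c1, fun x => ?_, ?_⟩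
  · have e : W x ^ 2 = α * x ^ 2 + β * x ^ 4 := by
      simp only [hW, mul_pow, Real.sq_sqrt (hpos x).le]; ring
    simp only [smul_eq_mul, hg, e]
    exact mul_le_mul_of_nonneg_right ((hge x).trans (le_abs_self _)) (by positivity)
  · rw [← c2]
    refine (setIntegral_le_integral hI (Filter.Eventually.of_forall fun t => ?_)).trans hE
    simp only [Pi.zero_apply, hg]; positivity

theorem stmt9 (b : ℝ) (hb1 : 3 / 8 < b) (hb2 : b < 1 / 2) :
    ∃ C > (0 : ℝ), ∀ ξ τ : ℝ,
      (∫ ξ₁ : ℝ, ∫ τ₁ : ℝ,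
          ξ ^ 2 /
            ((1 + |τ + ξ ^ 5|) ^ (2 * b) * (1 + |τ₁ + ξ₁ ^ 5|) ^ (2 * b) *
              (1 + |τ - τ₁ + (ξ - ξ₁) ^ 5|) ^ (2 * b))) ≤
        C * |ξ| ^ ((1 : ℝ) / 2) /
          ((1 + |τ + ξ ^ 5|) ^ (2 * b) * (1 + |τ + (1 / 16) * ξ ^ 5|) ^ (4 * b - 3 / 2)) := by
  have hp1 : 1 / 2 < 2 * b := by linarith
  have hp2 : 2 * b < 1 := by linarith
  have hs1 : 1 / 2 < 4 * b - 1 := by linarith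
  have hs2 : 4 * b - 1 < 1 := by linarith
  set K1 := ∫ t, auxH 1 (2 * b) t with hK1
  set K2 := ∫ t, auxH 1 (4 * b - 1) t with hK2
  have hK1n : 0 ≤ K1 := integral_nonneg fun t => auxH_nonneg one_pos _ t
  have hK2n : 0 ≤ K2 := integral_nonneg fun t => auxH_nonneg one_pos _ t
  set c1 : ℝ := 2 * ((1 / 2) ^ (1 - 2 * (2 * b)) * K1) with hc1
  have hc1n : 0 ≤ c1 := by positivity
  refine ⟨c1 * (√(5 / 2))⁻¹ * (2 * K2) + 1, by positivity, fun ξ τ => ?_⟩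
  rcases eq_or_ne ξ 0 with rfl | hξ
  · simp
  have hx : 0 < |ξ| := abs_pos.2 hξ
  set D := (1 + |τ + ξ ^ 5|) ^ (2 * b) with hD
  have hDpos : 0 < D := by positivity
  set A := τ + (1 / 16) * ξ ^ 5 with hA
  -- the inner integral
  have inner : ∀ ξ₁ : ℝ, (∫ τ₁ : ℝ, ξ ^ 2 / (D * (1 + |τ₁ + ξ₁ ^ 5|) ^ (2 * b) *
      (1 + |τ - τ₁ + (ξ - ξ₁) ^ 5|) ^ (2 * b))) ≤
      ξ ^ 2 / D * (c1 * (1 + |τ + ξ₁ ^ 5 + (ξ - ξ₁) ^ 5|) ^ (-(4 * b - 1))) := by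
    intro ξ₁
    have e : (fun τ₁ : ℝ => ξ ^ 2 / (D * (1 + |τ₁ + ξ₁ ^ 5|) ^ (2 * b) *
        (1 + |τ - τ₁ + (ξ - ξ₁) ^ 5|) ^ (2 * b))) = fun τ₁ => ξ ^ 2 / D *
        ((1 + |τ₁ - (-ξ₁ ^ 5)|) ^ (-(2 * b)) *
          (1 + |τ₁ - (τ + (ξ - ξ₁) ^ 5)|) ^ (-(2 * b))) := by
      funext τ₁
      rw [sub_neg_eq_add, abs_sub_comm τ₁, Real.rpow_neg (by positivity),
        Real.rpow_neg (by positivity),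
        show τ + (ξ - ξ₁) ^ 5 - τ₁ = τ - τ₁ + (ξ - ξ₁) ^ 5 by ring]
      field_simp
    rw [e, integral_const_mul]
    refine mul_le_mul_of_nonneg_left ((conv_bound_s9 hp1 hp2 _ _).trans_eq ?_) (by positivity)
    rw [abs_sub_comm, show τ + (ξ - ξ₁) ^ 5 - -ξ₁ ^ 5 = τ + ξ₁ ^ 5 + (ξ - ξ₁) ^ 5 by ring,
      div_eq_mul_one_div, Real.mul_rpow (by positivity) (by positivity), hc1,
      show -(4 * b - 1) = 1 - 2 * (2 * b) by ring]
    ring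
  obtain ⟨F, hFI, hFle, hFint⟩ := cov_bound hs1 hs2 A (5 / 2 * |ξ| ^ 3) (5 * |ξ|)
    (by positivity) (by positivity)
  rw [← hK2] at hFint
  have hα : 0 < √(5 / 2 * |ξ| ^ 3) := Real.sqrt_pos.2 (by positivity)
  set E := ξ ^ 2 / D * (c1 * (√(5 / 2 * |ξ| ^ 3))⁻¹) with hE
  have hEn : 0 ≤ E := by positivity
  have outer : ∀ ξ₁ : ℝ, (∫ τ₁ : ℝ, ξ ^ 2 / (D * (1 + |τ₁ + ξ₁ ^ 5|) ^ (2 * b) *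
      (1 + |τ - τ₁ + (ξ - ξ₁) ^ 5|) ^ (2 * b))) ≤ E * F (ξ₁ - ξ / 2) := by
    intro ξ₁
    refine (inner ξ₁).trans ?_
    set x := ξ₁ - ξ / 2 with hxd
    have id1 : τ + ξ₁ ^ 5 + (ξ - ξ₁) ^ 5 = A + ξ * (5 / 2 * ξ ^ 2 * x ^ 2 + 5 * x ^ 4) := by
      rw [hxd, hA]; ring
    have id2 : |ξ * (5 / 2 * ξ ^ 2 * x ^ 2 + 5 * x ^ 4)| =
        5 / 2 * |ξ| ^ 3 * x ^ 2 + 5 * |ξ| * x ^ 4 := by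
      rw [abs_mul, abs_of_nonneg (by positivity : 0 ≤ 5 / 2 * ξ ^ 2 * x ^ 2 + 5 * x ^ 4),
        ← sq_abs ξ]
      ring
    have h3 : |((5 / 2 * |ξ| ^ 3 * x ^ 2 + 5 * |ξ| * x ^ 4) - |A|)| ≤
        |τ + ξ₁ ^ 5 + (ξ - ξ₁) ^ 5| := by
      rw [id1, ← id2]
      have := abs_abs_sub_abs_le_abs_sub (ξ * (5 / 2 * ξ ^ 2 * x ^ 2 + 5 * x ^ 4)) (-A)
      rw [abs_neg, sub_neg_eq_add, add_comm _ A] at this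
      exact this
    have h4 : (1 + |τ + ξ₁ ^ 5 + (ξ - ξ₁) ^ 5|) ^ (-(4 * b - 1)) ≤
        (√(5 / 2 * |ξ| ^ 3))⁻¹ * F x := by
      rw [← div_eq_inv_mul, le_div_iff₀' hα]
      refine le_trans (mul_le_mul_of_nonneg_left ?_ hα.le) (hFle x)
      exact Real.rpow_le_rpow_of_nonpos (by positivity) (by linarith) (by linarith)
    calc _ ≤ ξ ^ 2 / D * (c1 * ((√(5 / 2 * |ξ| ^ 3))⁻¹ * F x)) := by gcongr
      _ = E * F x := by rw [hE]; ring
  have hfin := integral_mono_of_nonneg (μ := volume)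
    (Filter.Eventually.of_forall fun ξ₁ => integral_nonneg fun τ₁ => by
      simp only [Pi.zero_apply]; positivity)
    ((hFI.comp_sub_right (ξ / 2)).const_mul E) (Filter.Eventually.of_forall outer)
  refine hfin.trans ?_
  rw [integral_const_mul, integral_sub_right_eq_self F]
  refine (mul_le_mul_of_nonneg_left hFint hEn).trans ?_
  have hsq : ξ ^ 2 * (√(5 / 2 * |ξ| ^ 3))⁻¹ = (√(5 / 2))⁻¹ * |ξ| ^ ((1 : ℝ) / 2) := by
    rw [Real.sqrt_mul (by norm_num), ← Real.sqrt_eq_rpow,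
      show |ξ| ^ 3 = |ξ| ^ 2 * |ξ| by ring, Real.sqrt_mul (by positivity),
      Real.sqrt_sq hx.le, ← sq_abs ξ]
    have hq : 0 < √|ξ| := Real.sqrt_pos.2 hx
    have hq2 : √|ξ| * √|ξ| = |ξ| := Real.mul_self_sqrt hx.le
    field_simp
    nlinarith
  have hP : (1 + |A|) ^ (1 / 2 - (4 * b - 1)) = ((1 + |A|) ^ (4 * b - 3 / 2))⁻¹ := by
    rw [← Real.rpow_neg (by positivity)]; congr 1; ring
  set P := (1 + |A|) ^ (4 * b - 3 / 2) with hPd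
  have hPpos : 0 < P := by positivity
  rw [hP]
  calc E * (2 * (P⁻¹ * K2))
      = (ξ ^ 2 * (√(5 / 2 * |ξ| ^ 3))⁻¹) * (c1 * (2 * K2)) / (D * P) := by
        rw [hE]; field_simp
    _ = (c1 * (√(5 / 2))⁻¹ * (2 * K2)) * |ξ| ^ ((1 : ℝ) / 2) / (D * P) := by
        rw [hsq]; ring
    _ ≤ _ := by
        gcongr
        linarith
end

section
/- Let 2/5 ≤ b < 1/2 and 0 ≤ a ≤ 10b - 4. Then there exists C > 0 (depending only on a, b) such that for all ξ, τ ∈ ℝ with |ξ| ≥ 1, ⟨ξ⟩^{2a} |ξ|^{1/2} ≤ C ⟨τ+ξ⁵⟩^{2b} ⟨τ + (1/16)ξ⁵⟩^{4b - 3/2}. -/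
open MeasureTheory

theorem stmt10 (b a : ℝ) (hb1 : 2 / 5 ≤ b) (hb2 : b < 1 / 2) (ha1 : 0 ≤ a)
    (ha2 : a ≤ 10 * b - 4) :
    ∃ C > (0 : ℝ), ∀ ξ τ : ℝ, 1 ≤ |ξ| →
      (1 + |ξ|) ^ (2 * a) * |ξ| ^ ((1 : ℝ) / 2) ≤
        C * (1 + |τ + ξ ^ 5|) ^ (2 * b) * (1 + |τ + (1 / 16) * ξ ^ 5|) ^ (4 * b - 3 / 2) := by
  refine ⟨(64 : ℝ) ^ (4 * b - 3 / 2), by positivity, fun ξ τ hξ => ?_⟩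
  have hsum : 15 / 16 * |ξ| ^ 5 ≤ |τ + ξ ^ 5| + |τ + (1 / 16) * ξ ^ 5| := by
    have h := abs_sub (τ + ξ ^ 5) (τ + (1 / 16) * ξ ^ 5)
    have e : (τ + ξ ^ 5) - (τ + (1 / 16) * ξ ^ 5) = 15 / 16 * ξ ^ 5 := by ring
    rw [e, abs_mul, abs_pow, abs_of_pos (by norm_num : (0 : ℝ) < 15 / 16)] at h
    exact h
  have hA := abs_nonneg (τ + ξ ^ 5)
  have hB := abs_nonneg (τ + (1 / 16) * ξ ^ 5)
  generalize |τ + ξ ^ 5| = A at *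
  generalize |τ + (1 / 16) * ξ ^ 5| = B at *
  generalize |ξ| = x at *
  have hx0 : 0 ≤ x := by linarith
  have h5 : (1 + x) ^ 5 ≤ 64 * ((1 + A) * (1 + B)) := by
    have h1 : (1 + x) ^ 5 ≤ (2 * x) ^ 5 := by gcongr; linarith
    have h2 : (2 * x) ^ 5 = 32 * x ^ 5 := by ring
    have h3 : 0 ≤ x ^ 5 := by positivity
    nlinarith [mul_nonneg hA hB]
  calc (1 + x) ^ (2 * a) * x ^ ((1 : ℝ) / 2)
      ≤ (1 + x) ^ (2 * a) * (1 + x) ^ ((1 : ℝ) / 2) := by gcongr; linarith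
    _ = (1 + x) ^ (2 * a + 1 / 2) := by rw [Real.rpow_add (by linarith)]
    _ ≤ (1 + x) ^ ((5 : ℕ) * (4 * b - 3 / 2)) := by
        apply Real.rpow_le_rpow_of_exponent_le (by linarith)
        push_cast
        linarith
    _ = ((1 + x) ^ 5) ^ (4 * b - 3 / 2) := by
        rw [Real.rpow_mul (by linarith), Real.rpow_natCast]
    _ ≤ (64 * ((1 + A) * (1 + B))) ^ (4 * b - 3 / 2) := by
        apply Real.rpow_le_rpow (by positivity) h5 (by linarith)
    _ = 64 ^ (4 * b - 3 / 2) * (1 + A) ^ (4 * b - 3 / 2) * (1 + B) ^ (4 * b - 3 / 2) := by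
        rw [Real.mul_rpow (by norm_num) (by positivity),
          Real.mul_rpow (by positivity) (by positivity), mul_assoc]
    _ ≤ _ := by
        gcongr ?_ * ?_ * ?_
        · exact Real.rpow_le_rpow_of_exponent_le (by linarith) (by linarith)
end
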